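/- Let n ≥ 2 and let A be a unital associative algebra over a commutative unital ring R that is 2-torsion free and (n−1)-torsion free, with a nontrivial idempotent e, f = 1 − e, satisfying property (Q). Suppose at least one of: (i-1) eAe = S(eAe) and fAf = S(fAf); (i-2) eAe = S(eAe) and Z(eAe) = eZ(A)e; (i-3) fAf = S(fAf) and Z(fAf) = fZ(A)f; (i-4) Z(eAe) = eZ(A)e, Z(fAf) = fZ(A)f, and in case n ≥ 3 additionally eAe or fAf satisfies condition (*). Suppose also at least one of: (ii-1) eAe or fAf has no nonzero central ideal; (ii-2) eAf·fAe = {0} and fAe·eAf = {0}. Suppose finally (iii): for each x ∈ A, exf·fAe = {0} = fAe·exf implies exf = 0, and eAf·fxe = {0} = fxe·eAf implies fxe = 0. Then every Lie n-derivation on A is standard. -/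

import Mathlib

open Finset

/-- Iterated commutator: `pCom x k = p_{k+1}(x 0, ..., x k)`, i.e.
`pCom x 0 = x 0` and `pCom x (k+1) = [pCom x k, x (k+1)]`. -/
def pCom {A : Type*} [Ring A] (x : ℕ → A) : ℕ → A
  | 0 => x 0
  | k + 1 => pCom x k * x (k + 1) - x (k + 1) * pCom x k

/-- `φ` is a Lie `n`-derivation. -/
def IsLieNDeriv {R : Type*} {A : Type*} [CommRing R] [Ring A] [Algebra R A]
    (n : ℕ) (φ : A →ₗ[R] A) : Prop :=
  ∀ x : ℕ → A,
    φ (pCom x (n - 1)) =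
      ∑ i ∈ Finset.range n, pCom (Function.update x i (φ (x i))) (n - 1)

/-- `d` is a derivation. -/
def IsDeriv {R : Type*} {A : Type*} [CommRing R] [Ring A] [Algebra R A]
    (d : A →ₗ[R] A) : Prop :=
  ∀ x y : A, d (x * y) = d x * y + x * d y

/-- `δ` is a Jordan derivation. -/
def IsJordanDeriv {R : Type*} {A : Type*} [CommRing R] [Ring A] [Algebra R A]
    (δ : A →ₗ[R] A) : Prop :=
  ∀ x y : A, δ (x * y + y * x) = δ x * y + y * δ x + x * δ y + δ y * x

/-- `δ` is an antiderivation. -/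
def IsAntiDeriv {R : Type*} {A : Type*} [CommRing R] [Ring A] [Algebra R A]
    (δ : A →ₗ[R] A) : Prop :=
  ∀ x y : A, δ (x * y) = δ y * x + y * δ x

/-- `δ` is a singular Jordan derivation relative to the idempotent `e`
(with `f = 1 - e`): it is a Jordan derivation killing `eAe` and `fAf`,
mapping `eAf` into `fAe` and `fAe` into `eAf`. -/
def IsSingularJordanDeriv {R : Type*} {A : Type*} [CommRing R] [Ring A] [Algebra R A]
    (e : A) (δ : A →ₗ[R] A) : Prop :=
  IsJordanDeriv δ ∧
  (∀ a : A, δ (e * a * e) = 0) ∧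
  (∀ b : A, δ ((1 - e) * b * (1 - e)) = 0) ∧
  (∀ m : A, δ (e * m * (1 - e)) = (1 - e) * δ (e * m * (1 - e)) * e) ∧
  (∀ t : A, δ ((1 - e) * t * e) = e * δ ((1 - e) * t * e) * (1 - e))

/-- `z` is a central element. -/
def IsCent {A : Type*} [Ring A] (z : A) : Prop := ∀ y : A, z * y = y * z

/-- The centre of `A` as a set. -/
def centerSet (A : Type*) [Ring A] : Set A := {z : A | ∀ y : A, z * y = y * z}

/-- `γ` vanishes on all `(n-1)`-th commutators. -/
def VanishesOnNCommutators {R : Type*} {A : Type*} [CommRing R] [Ring A] [Algebra R A]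
    (n : ℕ) (γ : A →ₗ[R] A) : Prop :=
  ∀ x : ℕ → A, γ (pCom x (n - 1)) = 0

/-- A Lie `n`-derivation is standard if it is the sum of a derivation and a
central-valued map vanishing on all `(n-1)`-th commutators. -/
def IsStandardLieNDeriv {R : Type*} {A : Type*} [CommRing R] [Ring A] [Algebra R A]
    (n : ℕ) (φ : A →ₗ[R] A) : Prop :=
  ∃ d γ : A →ₗ[R] A,
    IsDeriv d ∧ (∀ x : A, IsCent (γ x)) ∧ VanishesOnNCommutators n γ ∧ φ = d + γ

/-- Property (Q) for the idempotent `e` (with `f = 1 - e`):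
`exe·eAf = 0 = fAe·exe` implies `exe = 0`, and
`eAf·fxf = 0 = fxf·fAe` implies `fxf = 0`. -/
def PropQ {A : Type*} [Ring A] (e : A) : Prop :=
  (∀ x : A,
    ((∀ y : A, (e * x * e) * (e * y * (1 - e)) = 0) ∧
     (∀ y : A, ((1 - e) * y * e) * (e * x * e) = 0)) → e * x * e = 0) ∧
  (∀ x : A,
    ((∀ y : A, (e * y * (1 - e)) * ((1 - e) * x * (1 - e)) = 0) ∧
     (∀ y : A, ((1 - e) * x * (1 - e)) * ((1 - e) * y * e) = 0)) →
        (1 - e) * x * (1 - e) = 0)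

/-- `A` is `k`-torsion free. -/
def TorsionFreeAt (A : Type*) [Ring A] (k : ℕ) : Prop :=
  ∀ x : A, k • x = 0 → x = 0

/-- The centre of the corner algebra `gAg` (for an idempotent `g`). -/
def cornerCenter {A : Type*} [Ring A] (g : A) : Set A :=
  {z : A | z = g * z * g ∧ ∀ a : A, z * (g * a * g) = (g * a * g) * z}

/-- The corner algebra `gAg` has no nonzero central ideal: every
ideal of `gAg` consisting of elements central in `gAg` is zero. -/
def NoNonzeroCentralIdeal (R : Type*) [CommRing R] (A : Type*) [Ring A] [Algebra R A]
    (g : A) : Prop :=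
  ∀ I : Set A, (0 : A) ∈ I →
    (∀ x ∈ I, x = g * x * g) →
    (∀ x ∈ I, ∀ y ∈ I, x + y ∈ I) →
    (∀ r : R, ∀ x ∈ I, r • x ∈ I) →
    (∀ x ∈ I, ∀ a : A, (g * a * g) * x ∈ I) →
    (∀ x ∈ I, ∀ a : A, x * (g * a * g) ∈ I) →
    (∀ x ∈ I, ∀ a : A, x * (g * a * g) = (g * a * g) * x) →
    ∀ x ∈ I, x = 0

/-- The generating set of `S(gAg)`: all idempotents of `gAg` together with all
commutators of elements of `gAg`. -/
def cornerGenSet {A : Type*} [Ring A] (g : A) : Set A :=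
  {x : A | x = g * x * g ∧ x * x = x} ∪
  {x : A | ∃ a b : A, x = (g * a * g) * (g * b * g) - (g * b * g) * (g * a * g)}

/-- `gAg = S(gAg)`: the corner algebra is generated (as an algebra) by its
idempotents and commutators. -/
def CornerGenerated (R : Type*) [CommRing R] {A : Type*} [Ring A] [Algebra R A]
    (g : A) : Prop :=
  ∀ x : A, g * x * g ∈ NonUnitalAlgebra.adjoin R (cornerGenSet g)

/-- Condition (*) for the corner algebra `gAg`: if `[x, gAg] ⊆ Z(gAg)` then
`x ∈ Z(gAg)`. -/
def CornerCondStar {A : Type*} [Ring A] (g : A) : Prop :=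
  ∀ x : A, x = g * x * g →
    (∀ a : A, x * (g * a * g) - (g * a * g) * x ∈ cornerCenter g) →
    x ∈ cornerCenter g

/-- The iterated Leibniz sum attached to a map `φ` and the iterated commutator `pCom x k`. -/
def lieSum {A : Type*} [Ring A] (φ : A → A) (x : ℕ → A) : ℕ → A
  | 0 => φ (x 0)
  | k + 1 => lieSum φ x k * x (k + 1) - x (k + 1) * lieSum φ x k +
      (pCom x k * φ (x (k + 1)) - φ (x (k + 1)) * pCom x k)

/-- The commutator with a fixed element on the right. -/
def rightBracket {A : Type*} [Ring A] (e y : A) : A := y * e - e * y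

section IteratedCommutators

variable {A : Type*} [Ring A]

lemma pCom_congr {x y : ℕ → A} {k : ℕ} (h : ∀ i ≤ k, x i = y i) : pCom x k = pCom y k := by
  induction k with
  | zero => exact h 0 le_rfl
  | succ k ih =>
    simp only [pCom]
    rw [ih fun i hi => h i (hi.trans k.le_succ), h (k + 1) le_rfl]

lemma sum_pCom_update (φ : A → A) (x : ℕ → A) (k : ℕ) :
    ∑ i ∈ Finset.range (k + 1), pCom (Function.update x i (φ (x i))) k = lieSum φ x k := by
  induction k with
  | zero => simp [pCom, lieSum]
  | succ k ih =>
    rw [Finset.sum_range_succ, lieSum, ← ih, Finset.sum_mul, Finset.mul_sum,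
      ← Finset.sum_sub_distrib]
    congr 1
    · refine Finset.sum_congr rfl fun i hi => ?_
      have hne : k + 1 ≠ i := by have := Finset.mem_range.1 hi; omega
      simp only [pCom, Function.update_of_ne hne]
    · simp only [pCom, Function.update_self]
      rw [pCom_congr (y := x)]
      intro i hi
      exact Function.update_of_ne (by omega) _ _

lemma pCom_add_iterate {e : A} {x : ℕ → A} {s : ℕ} (hx : ∀ i, s < i → x i = e) (j : ℕ) :
    pCom x (s + j) = (rightBracket e)^[j] (pCom x s) := by
  induction j with
  | zero => rfl
  | succ j ih =>
    rw [Function.iterate_succ_apply', ← ih, ← add_assoc, pCom, hx _ (by omega), rightBracket]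

lemma lieSum_add_iterate {φ : A → A} {e : A} {x : ℕ → A} {s : ℕ}
    (hx : ∀ i, s < i → x i = e) (hφ : IsCent (φ e)) (j : ℕ) :
    lieSum φ x (s + j) = (rightBracket e)^[j] (lieSum φ x s) := by
  induction j with
  | zero => rfl
  | succ j ih =>
    rw [Function.iterate_succ_apply', ← ih, ← add_assoc, lieSum, hx _ (by omega), rightBracket,
      hφ, sub_self, add_zero]

lemma rightBracket_three {e : A} (he : e * e = e) (y : A) :
    rightBracket e (rightBracket e (rightBracket e y)) = rightBracket e y := by
  have h : ∀ z, e * (e * z) = e * z := fun z => by rw [← mul_assoc, he]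
  simp only [rightBracket, mul_sub, sub_mul, mul_assoc, he, h]
  abel

lemma rightBracket_iterate_odd {e : A} (he : e * e = e) (k : ℕ) (y : A) :
    (rightBracket e)^[2 * k + 1] y = rightBracket e y := by
  induction k with
  | zero => rfl
  | succ k ih =>
    rw [show 2 * (k + 1) + 1 = (2 * k + 1) + 1 + 1 by ring, Function.iterate_succ_apply',
      Function.iterate_succ_apply', ih, rightBracket_three he]

lemma rightBracket_iterate_even {e : A} (he : e * e = e) (k : ℕ) (y : A) :
    (rightBracket e)^[2 * k + 2] y = rightBracket e (rightBracket e y) := by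
  rw [Function.iterate_succ_apply', rightBracket_iterate_odd he]

end IteratedCommutators

section LieNDerivations

variable {R A : Type*} [CommRing R] [Ring A] [Algebra R A] {n : ℕ} {φ d : A →ₗ[R] A}

lemma isLieNDeriv_iff (hn : 1 ≤ n) :
    IsLieNDeriv n φ ↔ ∀ x : ℕ → A, φ (pCom x (n - 1)) = lieSum φ x (n - 1) := by
  obtain ⟨k, rfl⟩ := Nat.exists_eq_add_of_le' hn
  simp only [IsLieNDeriv, sum_pCom_update (fun y => φ y), Nat.add_sub_cancel]

lemma lieSum_of_isDeriv (hd : IsDeriv d) (x : ℕ → A) (k : ℕ) :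
    lieSum d x k = d (pCom x k) := by
  induction k with
  | zero => rfl
  | succ k ih =>
    rw [lieSum, ih, pCom, map_sub, hd, hd]
    abel

lemma lieSum_sub (x : ℕ → A) (k : ℕ) :
    lieSum (φ - d) x k = lieSum φ x k - lieSum d x k := by
  induction k with
  | zero => rfl
  | succ k ih =>
    rw [lieSum, ih, lieSum, lieSum, LinearMap.sub_apply]
    noncomm_ring

lemma IsLieNDeriv.sub_isDeriv (hn : 1 ≤ n) (hφ : IsLieNDeriv n φ) (hd : IsDeriv d) :
    IsLieNDeriv n (φ - d) := by
  rw [isLieNDeriv_iff hn] at hφ ⊢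
  intro x
  rw [lieSum_sub, LinearMap.sub_apply, hφ, lieSum_of_isDeriv hd]

/-- A centre-valued Lie `n`-derivation kills all `(n-1)`-th commutators. -/
lemma IsLieNDeriv.vanishes (hn : 2 ≤ n) (hφ : IsLieNDeriv n φ) (hc : ∀ x, IsCent (φ x)) :
    VanishesOnNCommutators n φ := by
  rw [isLieNDeriv_iff (by omega)] at hφ
  obtain ⟨k, rfl⟩ := Nat.exists_eq_add_of_le hn
  intro x
  rw [hφ, show 2 + k - 1 = k + 1 by omega]
  clear hφ
  induction k with
  | zero =>
    simp only [lieSum, pCom]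
    rw [hc, ← hc (x (0 + 1)), sub_self, sub_self, add_zero]
  | succ k ih =>
    rw [lieSum, ih (by omega), ← hc (x _)]
    simp

lemma isDeriv_inner (s : A) : ∃ d : A →ₗ[R] A, IsDeriv d ∧ ∀ x, d x = x * s - s * x := by
  refine ⟨LinearMap.mulRight R s - LinearMap.mulLeft R s, fun x y => ?_, fun x => rfl⟩
  simp only [LinearMap.sub_apply, LinearMap.mulRight_apply, LinearMap.mulLeft_apply]
  noncomm_ring

lemma IsDeriv.add {d' : A →ₗ[R] A} (hd : IsDeriv d) (hd' : IsDeriv d') : IsDeriv (d + d') := by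
  intro x y
  simp only [LinearMap.add_apply, hd x y, hd' x y]
  noncomm_ring

/-- The Leibniz defect of `φ` with respect to the commutator. -/
def lieDefect (φ : A →ₗ[R] A) (x y : A) : A :=
  φ (x * y - y * x) - (φ x * y - y * φ x + (x * φ y - φ y * x))

variable {e : A}

lemma lieDefect_eq_zero (hφ : IsLieNDeriv 2 φ) (x y : A) : lieDefect φ x y = 0 := by
  have h := (isLieNDeriv_iff (by omega)).1 hφ fun i => if i = 0 then x else y
  simp only [lieSum, pCom] at h
  rw [lieDefect, sub_eq_zero]
  simpa using h

lemma IsLieNDeriv.rightBracket_iterate_one (he : IsCent (φ e)) {j : ℕ}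
    (hφ : IsLieNDeriv (1 + j) φ) (x : A) :
    φ ((rightBracket e)^[j] x) = (rightBracket e)^[j] (φ x) := by
  have h := (isLieNDeriv_iff (by omega)).1 hφ fun i => if i = 0 then x else e
  rw [show 1 + j - 1 = 0 + j by omega,
    pCom_add_iterate (e := e) (fun i hi => if_neg (by omega)),
    lieSum_add_iterate (e := e) (fun i hi => if_neg (by omega)) he] at h
  simpa [lieSum, pCom] using h

lemma IsLieNDeriv.rightBracket_iterate_two (he : IsCent (φ e)) {j : ℕ}
    (hφ : IsLieNDeriv (2 + j) φ) (x y : A) :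
    φ ((rightBracket e)^[j] (x * y - y * x)) =
      (rightBracket e)^[j] (φ x * y - y * φ x + (x * φ y - φ y * x)) := by
  have h := (isLieNDeriv_iff (by omega)).1 hφ fun i => if i = 0 then x else if i = 1 then y else e
  rw [show 2 + j - 1 = 1 + j by omega,
    pCom_add_iterate (e := e) (fun i hi => by rw [if_neg (by omega), if_neg (by omega)]),
    lieSum_add_iterate (e := e) (fun i hi => by rw [if_neg (by omega), if_neg (by omega)]) he] at h
  simpa [lieSum, pCom] using h

lemma IsLieNDeriv.rightBracket_iterate_three (he : IsCent (φ e)) {j : ℕ}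
    (hφ : IsLieNDeriv (3 + j) φ) (x y z : A) :
    φ ((rightBracket e)^[j] ((x * y - y * x) * z - z * (x * y - y * x))) =
      (rightBracket e)^[j] ((φ x * y - y * φ x + (x * φ y - φ y * x)) * z
        - z * (φ x * y - y * φ x + (x * φ y - φ y * x))
        + ((x * y - y * x) * φ z - φ z * (x * y - y * x))) := by
  have h := (isLieNDeriv_iff (by omega)).1 hφ fun i =>
    if i = 0 then x else if i = 1 then y else if i = 2 then z else e
  rw [show 3 + j - 1 = 2 + j by omega,
    pCom_add_iterate (e := e) (fun i hi => by
      rw [if_neg (by omega), if_neg (by omega), if_neg (by omega)]),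
    lieSum_add_iterate (e := e) (fun i hi => by
      rw [if_neg (by omega), if_neg (by omega), if_neg (by omega)]) he] at h
  simpa [lieSum, pCom] using h

lemma IsLieNDeriv.map_rightBracket_commutator (hn : 2 ≤ n) (hφ : IsLieNDeriv n φ)
    (hee : e * e = e) (he : IsCent (φ e)) (x y : A) :
    φ (rightBracket e (x * y - y * x)) =
      rightBracket e (φ x * y - y * φ x + (x * φ y - φ y * x)) := by
  obtain ⟨j, rfl⟩ := Nat.exists_eq_add_of_le hn
  have h2 := hφ.rightBracket_iterate_two he x y
  have h1 := fun x => IsLieNDeriv.rightBracket_iterate_one (j := j + 1) he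
    (by rwa [show 1 + (j + 1) = 2 + j by ring]) x
  obtain ⟨k, rfl | rfl⟩ := j.even_or_odd'
  · simp only [rightBracket_iterate_odd hee] at h1
    rcases k with _ | k
    · rw [h1]; simpa using congrArg (rightBracket e) h2
    · simp only [show 2 * (k + 1) = 2 * k + 2 by ring, rightBracket_iterate_even hee] at h2
      rw [h1] at h2
      have := congrArg (rightBracket e) h2
      rwa [← h1, ← h1, rightBracket_three hee, rightBracket_three hee] at this
  · simpa only [rightBracket_iterate_odd hee] using h2

lemma IsLieNDeriv.rightBracket_map_commutator_three (hn : 3 ≤ n) (hφ : IsLieNDeriv n φ)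
    (hee : e * e = e) (he : IsCent (φ e)) (x y z : A) :
    rightBracket e (rightBracket e (φ ((x * y - y * x) * z - z * (x * y - y * x)))) =
      rightBracket e (rightBracket e ((φ x * y - y * φ x + (x * φ y - φ y * x)) * z
        - z * (φ x * y - y * φ x + (x * φ y - φ y * x))
        + ((x * y - y * x) * φ z - φ z * (x * y - y * x)))) := by
  obtain ⟨j, rfl⟩ := Nat.exists_eq_add_of_le hn
  have h3 := hφ.rightBracket_iterate_three he x y z
  have h1 := fun x => IsLieNDeriv.rightBracket_iterate_one (j := j + 2) he
    (by rwa [show 1 + (j + 2) = 3 + j by ring]) x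
  obtain ⟨k, rfl | rfl⟩ := j.even_or_odd'
  · simp only [rightBracket_iterate_even hee] at h1
    rcases k with _ | k
    · simpa using congrArg (fun w => rightBracket e (rightBracket e w)) h3
    · simp only [show 2 * (k + 1) = 2 * k + 2 by ring, rightBracket_iterate_even hee] at h3
      rwa [h1] at h3
  · simp only [show 2 * k + 1 + 2 = 2 * (k + 1) + 1 by ring, rightBracket_iterate_odd hee] at h1 h3
    rw [h1] at h3
    rw [h3]

end LieNDerivations

/-- `x` lies in the Peirce component `gAh`. -/
def IsPeirce {A : Type*} [Ring A] (g h x : A) : Prop := g * x = x ∧ x * h = x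

/-- A pair of complementary orthogonal idempotents satisfying property (Q), stated through
membership in the Peirce components so that the roles of `e` and `f` are interchangeable. -/
structure PeirceQ {A : Type*} [Ring A] (e f : A) : Prop where
  ee : e * e = e
  ff : f * f = f
  ef : e * f = 0
  fe : f * e = 0
  sum : e + f = 1
  left : ∀ a, IsPeirce e e a → (∀ m, IsPeirce e f m → a * m = 0) →
    (∀ t, IsPeirce f e t → t * a = 0) → a = 0
  right : ∀ b, IsPeirce f f b → (∀ t, IsPeirce f e t → b * t = 0) →
    (∀ m, IsPeirce e f m → m * b = 0) → b = 0

section Peirce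

variable {A : Type*} [Ring A] {e f g h k x y : A}

lemma IsPeirce.mul (hx : IsPeirce g h x) (hy : IsPeirce k f y) : IsPeirce g f (x * y) :=
  ⟨by rw [← mul_assoc, hx.1], by rw [mul_assoc, hy.2]⟩

lemma IsPeirce.add (hx : IsPeirce g h x) (hy : IsPeirce g h y) : IsPeirce g h (x + y) :=
  ⟨by rw [mul_add, hx.1, hy.1], by rw [add_mul, hx.2, hy.2]⟩

lemma IsPeirce.sub (hx : IsPeirce g h x) (hy : IsPeirce g h y) : IsPeirce g h (x - y) :=
  ⟨by rw [mul_sub, hx.1, hy.1], by rw [sub_mul, hx.2, hy.2]⟩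

lemma IsPeirce.commute_mul (hx : IsPeirce g h x) (hy : g * y = y * g) : IsPeirce g h (y * x) :=
  ⟨by rw [← mul_assoc, hy, mul_assoc, hx.1], by rw [mul_assoc, hx.2]⟩

lemma IsPeirce.mul_commute (hx : IsPeirce g h x) (hy : h * y = y * h) : IsPeirce g h (x * y) :=
  ⟨by rw [← mul_assoc, hx.1], by rw [mul_assoc, ← hy, ← mul_assoc, hx.2]⟩

lemma IsPeirce.sandwich (hx : IsPeirce g h x) : g * x * h = x := by rw [hx.1, hx.2]

lemma isPeirce_zero : IsPeirce g h (0 : A) := ⟨mul_zero _, zero_mul _⟩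

lemma IsPeirce.smul {R : Type*} [CommRing R] [Algebra R A] (r : R) (hx : IsPeirce g h x) :
    IsPeirce g h (r • x) :=
  ⟨by rw [mul_smul_comm, hx.1], by rw [smul_mul_assoc, hx.2]⟩

lemma IsPeirce.mul_eq_zero (hx : IsPeirce g h x) (hy : IsPeirce k f y) (hhk : h * k = 0) :
    x * y = 0 := by
  rw [← hx.2, ← hy.1, mul_assoc, ← mul_assoc h, hhk, zero_mul, mul_zero]

lemma IsCent.add (hx : IsCent x) (hy : IsCent y) : IsCent (x + y) := fun z => by
  rw [add_mul, mul_add, hx, hy]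

lemma IsCent.sub (hx : IsCent x) (hy : IsCent y) : IsCent (x - y) := fun z => by
  rw [sub_mul, mul_sub, hx, hy]

lemma IsCent.neg (hx : IsCent x) : IsCent (-x) := fun z => by
  rw [neg_mul, mul_neg, hx]

lemma IsCent.mul (hx : IsCent x) (hy : IsCent y) : IsCent (x * y) := fun z => by
  rw [mul_assoc, hy, ← mul_assoc, hx, mul_assoc]

lemma IsCent.smul {R : Type*} [CommRing R] [Algebra R A] (r : R) (hx : IsCent x) :
    IsCent (r • x) := fun z => by
  rw [smul_mul_assoc, mul_smul_comm, hx]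

lemma isCent_zero : IsCent (0 : A) := fun z => by rw [zero_mul, mul_zero]

namespace PeirceQ

variable (P : PeirceQ e f)
include P

lemma symm : PeirceQ f e where
  ee := P.ff
  ff := P.ee
  ef := P.fe
  fe := P.ef
  sum := by rw [add_comm, P.sum]
  left := P.right
  right := P.left

lemma eq_one_sub : f = 1 - e := by rw [← P.sum]; abel

lemma isPeirce_ee (x : A) : IsPeirce e e (e * x * e) :=
  ⟨by simp only [← mul_assoc, P.ee], by simp only [mul_assoc, P.ee]⟩

lemma isPeirce_ef (x : A) : IsPeirce e f (e * x * f) :=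
  ⟨by simp only [← mul_assoc, P.ee], by simp only [mul_assoc, P.ff]⟩

lemma decomp (x : A) : x = e * x * e + e * x * f + (f * x * e + f * x * f) := by
  rw [← mul_add, ← mul_add, P.sum, ← add_mul, ← add_mul, P.sum, mul_one, one_mul]

lemma mulE_of_M (hx : IsPeirce e f x) : x * e = 0 := by rw [← hx.2, mul_assoc, P.fe, mul_zero]

lemma fmul_of_M (hx : IsPeirce e f x) : f * x = 0 := by rw [← hx.1, ← mul_assoc, P.fe, zero_mul]

lemma fmul_of_ee (hx : IsPeirce e e x) : f * x = 0 := by rw [← hx.1, ← mul_assoc, P.fe, zero_mul]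

lemma mulF_of_ee (hx : IsPeirce e e x) : x * f = 0 := by rw [← hx.2, mul_assoc, P.ef, mul_zero]

lemma comm_f (h : e * x = x * e) : f * x = x * f := by
  rw [P.eq_one_sub, sub_mul, mul_sub, h, one_mul, mul_one]

lemma comm_iff : f * x = x * f ↔ e * x = x * e := ⟨P.symm.comm_f, P.comm_f⟩

omit P in
lemma comm_of_ee (hx : IsPeirce e e x) : e * x = x * e := by rw [hx.1, hx.2]

lemma comm_of_ff (hx : IsPeirce f f x) : e * x = x * e := P.comm_iff.1 (comm_of_ee hx)

lemma isPeirce_emul (h : e * x = x * e) : IsPeirce e e (e * x) :=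
  ⟨by rw [← mul_assoc, P.ee], by rw [mul_assoc, ← h, ← mul_assoc, P.ee]⟩

lemma induction {p : A → Prop} (hadd : ∀ x y, p x → p y → p (x + y))
    (hee : ∀ x, IsPeirce e e x → p x) (hef : ∀ x, IsPeirce e f x → p x)
    (hfe : ∀ x, IsPeirce f e x → p x) (hff : ∀ x, IsPeirce f f x → p x) (x : A) : p x := by
  rw [P.decomp x]
  exact hadd _ _ (hadd _ _ (hee _ (P.isPeirce_ee x)) (hef _ (P.isPeirce_ef x)))
    (hadd _ _ (hfe _ (P.symm.isPeirce_ef x)) (hff _ (P.symm.isPeirce_ee x)))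

lemma commute_ee {z a : A} (hz : e * z = z * e) (hM : ∀ m, IsPeirce e f m → z * m = m * z)
    (hN : ∀ t, IsPeirce f e t → z * t = t * z) (ha : IsPeirce e e a) : z * a = a * z := by
  have h1 := ha.1
  have h2 := ha.2
  refine sub_eq_zero.1 (P.left _ ⟨?_, ?_⟩ (fun m hm => ?_) fun t ht => ?_)
  · rw [mul_sub, ← mul_assoc, hz, mul_assoc, h1, ← mul_assoc, h1]
  · rw [sub_mul, mul_assoc, h2, mul_assoc, ← hz, ← mul_assoc, h2]
  · rw [sub_mul, mul_assoc, hM _ (ha.mul hm), mul_assoc, mul_assoc, hM _ hm, sub_self]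
  · rw [mul_sub, ← mul_assoc t a, ← hN _ (ht.mul ha), ← mul_assoc, ← hN _ ht, mul_assoc, sub_self]

lemma isCent_of_commute {z : A} (hz : e * z = z * e)
    (hM : ∀ m, IsPeirce e f m → z * m = m * z)
    (hN : ∀ t, IsPeirce f e t → z * t = t * z) : IsCent z := by
  refine P.induction (fun x y hx hy => ?_) (fun a ha => P.commute_ee hz hM hN ha) hM hN
    fun b hb => P.symm.commute_ee (P.comm_f hz) hN hM hb
  rw [mul_add, add_mul, hx, hy]

lemma eq_zero_of_isCent {z : A} (hz : IsCent z) (hze : e * z = 0) : z = 0 := by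
  have hfz : f * z = z := by rw [P.eq_one_sub, sub_mul, hze, one_mul, sub_zero]
  refine P.right z ⟨hfz, by rw [hz, hfz]⟩ (fun t ht => ?_) fun m hm => ?_
  · rw [hz, ← ht.2, mul_assoc, hze, mul_zero]
  · rw [← hz, ← hm.1, ← mul_assoc, hz, hze, zero_mul]

end PeirceQ

end Peirce

section Normalization

variable {R A : Type*} [CommRing R] [Ring A] [Algebra R A] {n : ℕ} {φ : A →ₗ[R] A} {e f : A}

lemma pCom_eq_neg_one_pow_smul (P : PeirceQ e f) {m : A} (hm : IsPeirce e f m) (k : ℕ) :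
    pCom (fun i => if i = 0 then m else e) k = (-1 : ℤ) ^ k • m := by
  induction k with
  | zero => simp [pCom]
  | succ k ih =>
    rw [pCom, ih, if_neg (by omega), smul_mul_assoc, mul_smul_comm, P.mulE_of_M hm, hm.1, pow_succ]
    simp

lemma pCom_eq_self (P : PeirceQ e f) {t : A} (ht : IsPeirce f e t) (k : ℕ) :
    pCom (fun i => if i = 0 then t else e) k = t := by
  induction k with
  | zero => simp [pCom]
  | succ k ih => rw [pCom, ih, if_neg (by omega), ht.2, P.symm.fmul_of_M ht, sub_zero]

lemma peirce_ef_lieSum (P : PeirceQ e f) (he : e * φ e = φ e * e) {m : A} (hm : IsPeirce e f m)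
    (k : ℕ) :
    e * lieSum φ (fun i => if i = 0 then m else e) k * f =
      (-1 : ℤ) ^ k • (e * φ m * f - k • (m * φ e - φ e * m)) := by
  induction k with
  | zero => simp [lieSum]
  | succ k ih =>
    have h1 : e * (m * φ e - φ e * m) * f = m * φ e - φ e * m :=
      ((hm.mul_commute (P.comm_f he)).sub (hm.commute_mul he)).sandwich
    have h2 : ∀ z, e * (z * e - e * z) * f = -(e * z * f) := fun z => by
      rw [mul_sub, sub_mul, mul_assoc, mul_assoc z, P.ef, ← mul_assoc e e, P.ee]; simp
    rw [lieSum, if_neg (by omega), pCom_eq_neg_one_pow_smul P hm, mul_add, add_mul, h2, ih,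
      smul_mul_assoc, mul_smul_comm, ← smul_sub, mul_smul_comm, smul_mul_assoc, h1, pow_succ]
    module

lemma peirce_fe_lieSum (P : PeirceQ e f) (he : e * φ e = φ e * e) {t : A} (ht : IsPeirce f e t)
    (k : ℕ) :
    f * lieSum φ (fun i => if i = 0 then t else e) k * e =
      f * φ t * e + k • (t * φ e - φ e * t) := by
  induction k with
  | zero => simp [lieSum]
  | succ k ih =>
    have h1 : f * (t * φ e - φ e * t) * e = t * φ e - φ e * t :=
      ((ht.mul_commute he).sub (ht.commute_mul (P.comm_f he))).sandwich
    have h2 : ∀ z, f * (z * e - e * z) * e = f * z * e := fun z => by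
      rw [mul_sub, sub_mul, mul_assoc, mul_assoc z, P.ee, ← mul_assoc f e, P.fe]; simp [mul_assoc]
    rw [lieSum, if_neg (by omega), pCom_eq_self P ht, mul_add, add_mul, h2, ih, h1]
    module

lemma IsLieNDeriv.isCent_map_idempotent (P : PeirceQ e f) (hn : 2 ≤ n)
    (hn1 : TorsionFreeAt A (n - 1)) (hφ : IsLieNDeriv n φ) (he : e * φ e = φ e * e) :
    IsCent (φ e) := by
  have h := (isLieNDeriv_iff (by omega)).1 hφ
  refine P.isCent_of_commute he (fun m hm => ?_) fun t ht => ?_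
  · have h' := congrArg (fun z => (-1 : ℤ) ^ (n - 1) • (e * z * f))
      (h fun i => if i = 0 then m else e)
    simp only [peirce_ef_lieSum P he hm, pCom_eq_neg_one_pow_smul P hm, map_zsmul, mul_smul_comm,
      smul_mul_assoc, smul_smul, ← mul_pow] at h'
    norm_num only [one_pow, one_smul] at h'
    exact (sub_eq_zero.1 (hn1 _ (sub_eq_self.1 h'.symm))).symm
  · have h' := congrArg (fun z => f * z * e) (h fun i => if i = 0 then t else e)
    simp only [peirce_fe_lieSum P he ht, pCom_eq_self P ht] at h'
    exact (sub_eq_zero.1 (hn1 _ (left_eq_add.1 h'))).symm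

end Normalization

/-- Compatibility of a linear map with the Peirce decomposition: block diagonal elements are
preserved, and on the off-diagonal part the map splits into a component preserving `eAf` and `fAe`
and a component exchanging them. -/
structure PeirceCompatible {R A : Type*} [CommRing R] [Ring A] [Algebra R A] (e f : A)
    (φ : A →ₗ[R] A) : Prop where
  diag : ∀ w, e * w = w * e → e * φ w = φ w * e
  mapM : ∀ m, IsPeirce e f m → φ m = e * φ m * f + f * φ m * e
  mapN : ∀ t, IsPeirce f e t → φ t = f * φ t * e + e * φ t * f
  ruleM : ∀ w m, e * w = w * e → IsPeirce e f m →
    e * φ (w * m - m * w) * f = φ w * m - m * φ w + (w * (e * φ m * f) - e * φ m * f * w)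
  ruleM_swap : ∀ w m, e * w = w * e → IsPeirce e f m →
    f * φ (w * m - m * w) * e = f * φ m * e * w - w * (f * φ m * e)
  ruleN : ∀ w t, e * w = w * e → IsPeirce f e t →
    f * φ (w * t - t * w) * e = φ w * t - t * φ w + (w * (f * φ t * e) - f * φ t * e * w)
  ruleN_swap : ∀ w t, e * w = w * e → IsPeirce f e t →
    e * φ (w * t - t * w) * f = e * φ t * f * w - w * (e * φ t * f)
  defect : ∀ x y, e * (x * y - y * x) = (x * y - y * x) * e →
    IsCent (e * lieDefect φ x y * e + f * lieDefect φ x y * f)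

section PeirceCompatible

variable {R A : Type*} [CommRing R] [Ring A] [Algebra R A] {n : ℕ} {φ : A →ₗ[R] A} {e f : A}

lemma PeirceCompatible.symm (P : PeirceQ e f) (H : PeirceCompatible e f φ) :
    PeirceCompatible f e φ where
  diag w hw := P.comm_f (H.diag w (P.comm_iff.1 hw))
  mapM := H.mapN
  mapN := H.mapM
  ruleM w t hw := H.ruleN w t (P.comm_iff.1 hw)
  ruleM_swap w t hw := H.ruleN_swap w t (P.comm_iff.1 hw)
  ruleN w t hw := H.ruleM w t (P.comm_iff.1 hw)
  ruleN_swap w t hw := H.ruleM_swap w t (P.comm_iff.1 hw)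
  defect x y hxy := by
    rw [add_comm]
    exact H.defect x y (P.comm_iff.1 hxy)

lemma rightBracket_of_M (P : PeirceQ e f) {m : A} (hm : IsPeirce e f m) :
    rightBracket e m = -m := by
  rw [rightBracket, P.mulE_of_M hm, hm.1, zero_sub]

lemma rightBracket_of_N (P : PeirceQ e f) {t : A} (ht : IsPeirce f e t) :
    rightBracket e t = t := by
  rw [rightBracket, ht.2, P.symm.fmul_of_M ht, sub_zero]

lemma mul_rightBracket_mul (P : PeirceQ e f) (x : A) :
    e * rightBracket e x * f = -(e * x * f) := by
  rw [rightBracket, mul_sub, sub_mul, mul_assoc, mul_assoc x, P.ef, ← mul_assoc e e, P.ee]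
  simp

lemma mul_rightBracket_mul' (P : PeirceQ e f) (x : A) :
    f * rightBracket e x * e = f * x * e := by
  rw [rightBracket, mul_sub, sub_mul, mul_assoc, mul_assoc x, P.ee, ← mul_assoc f e, P.fe]
  simp [mul_assoc]

lemma rightBracket_eq_zero_iff {x : A} : rightBracket e x = 0 ↔ e * x = x * e := by
  rw [rightBracket, sub_eq_zero, eq_comm]

lemma peirce_bracket_eq (P : PeirceQ e f) {w : A} (hw : e * w = w * e) (x : A) :
    e * (w * x - x * w) * f = w * (e * x * f) - e * x * f * w := by
  have hwf := P.comm_f hw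
  rw [mul_sub, sub_mul, ← mul_assoc, hw, ← mul_assoc, mul_assoc _ w f, ← hwf]
  simp only [mul_assoc]

lemma isPeirce_bracket (P : PeirceQ e f) {w m : A} (hw : e * w = w * e) (hm : IsPeirce e f m) :
    IsPeirce e f (w * m - m * w) :=
  (hm.commute_mul hw).sub (hm.mul_commute (P.comm_f hw))

lemma corner_commute (P : PeirceQ e f) {x m : A} (hm : IsPeirce e f m)
    (h : e * (x * m - m * x) * f = 0) :
    (e * x * e + f * x * f) * m = m * (e * x * e + f * x * f) := by
  rw [mul_sub, sub_mul, sub_eq_zero] at h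
  rw [add_mul, mul_add, mul_assoc (f * x), P.fmul_of_M hm, mul_assoc (e * x), hm.1,
    ← mul_assoc m, ← mul_assoc m (f * x), ← mul_assoc m e, P.mulE_of_M hm, ← mul_assoc m f, hm.2]
  rw [← mul_assoc, mul_assoc _ m, hm.2, ← mul_assoc e m, hm.1] at h
  simp [h]

lemma commute_diag (P : PeirceQ e f) (x : A) :
    e * (e * x * e + f * x * f) = (e * x * e + f * x * f) * e := by
  rw [mul_add, add_mul, (P.isPeirce_ee x).1, (P.isPeirce_ee x).2,
    P.symm.fmul_of_ee (P.symm.isPeirce_ee x), P.symm.mulF_of_ee (P.symm.isPeirce_ee x)]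

lemma IsLieNDeriv.peirceCompatible (P : PeirceQ e f) (hn : 2 ≤ n) (hφ : IsLieNDeriv n φ)
    (he : IsCent (φ e)) : PeirceCompatible e f φ := by
  have H1 := hφ.map_rightBracket_commutator hn P.ee he
  have hEE : ∀ x,
      φ (rightBracket e (rightBracket e x)) = rightBracket e (rightBracket e (φ x)) := by
    intro x
    have := H1 x e
    rwa [he, sub_self, add_zero] at this
  have hE : ∀ x, rightBracket e (rightBracket e x) = e * x * f + f * x * e := by
    intro x
    rw [P.eq_one_sub]
    simp only [rightBracket, sub_mul, mul_sub, mul_one, one_mul, mul_assoc, P.ee,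
      ← mul_assoc e e]
    abel
  have hM : ∀ w m, e * w = w * e → IsPeirce e f m → φ (w * m - m * w) =
      -rightBracket e (φ w * m - m * φ w + (w * φ m - φ m * w)) := by
    intro w m hw hm
    rw [← H1, rightBracket_of_M P (isPeirce_bracket P hw hm), map_neg, neg_neg]
  have hN : ∀ w t, e * w = w * e → IsPeirce f e t → φ (w * t - t * w) =
      rightBracket e (φ w * t - t * φ w + (w * φ t - φ t * w)) := by
    intro w t hw ht
    rw [← H1, rightBracket_of_N P (isPeirce_bracket P.symm (P.comm_f hw) ht)]
  have hdiag : ∀ w, e * w = w * e → e * φ w = φ w * e := by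
    intro w hw
    have h := hEE w
    rw [rightBracket_eq_zero_iff.2 hw] at h
    rw [← rightBracket_eq_zero_iff, ← rightBracket_three P.ee, ← h]
    simp [rightBracket]
  have hzero : ∀ w, e * w = w * e → e * w * f = 0 := fun w hw => by
    rw [hw, mul_assoc, P.ef, mul_zero]
  have hzero' : ∀ w, e * w = w * e → f * w * e = 0 := fun w hw => by
    rw [mul_assoc, ← hw, ← mul_assoc, P.fe, zero_mul]
  have hruleM : ∀ w m, e * w = w * e → IsPeirce e f m →
      e * φ (w * m - m * w) * f =
        φ w * m - m * φ w + (w * (e * φ m * f) - e * φ m * f * w) := by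
    intro w m hw hm
    rw [hM w m hw hm, mul_neg, neg_mul, mul_rightBracket_mul P, neg_neg, mul_add, add_mul,
      peirce_bracket_eq P hw, (isPeirce_bracket P (hdiag w hw) hm).sandwich]
  have hruleN : ∀ w t, e * w = w * e → IsPeirce f e t →
      f * φ (w * t - t * w) * e =
        φ w * t - t * φ w + (w * (f * φ t * e) - f * φ t * e * w) := by
    intro w t hw ht
    rw [hN w t hw ht, mul_rightBracket_mul' P, mul_add, add_mul,
      peirce_bracket_eq P.symm (P.comm_f hw),
      (isPeirce_bracket P.symm (P.comm_f (hdiag w hw)) ht).sandwich]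
  refine ⟨hdiag, fun m hm => ?_, fun t ht => ?_, hruleM, ?_, hruleN, ?_, ?_⟩
  · have h := hEE m
    rw [rightBracket_of_M P hm, ← neg_one_smul ℤ m] at h
    rw [← hE, ← hEE, rightBracket_of_M P hm, ← neg_one_smul ℤ m]
    simp [rightBracket, P.mulE_of_M hm, hm.1]
  · rw [add_comm, ← hE, ← hEE, rightBracket_of_N P ht, rightBracket_of_N P ht]
  · intro w m hw hm
    have hk := isPeirce_bracket P (hdiag w hw) hm
    rw [hM w m hw hm, mul_neg, neg_mul, mul_rightBracket_mul' P, mul_add, add_mul,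
      peirce_bracket_eq P.symm (P.comm_f hw), P.fmul_of_M hk, zero_mul, zero_add, neg_sub]
  · intro w t hw ht
    have hk := isPeirce_bracket P.symm (P.comm_f (hdiag w hw)) ht
    rw [hN w t hw ht, mul_rightBracket_mul P, mul_add, add_mul,
      peirce_bracket_eq P hw, P.symm.fmul_of_M hk, zero_mul, zero_add, neg_sub]
  · intro x y hxy
    rcases hn.eq_or_lt with rfl | hn
    · rw [lieDefect_eq_zero hφ]
      simpa using isCent_zero
    have H3 := hφ.rightBracket_map_commutator_three hn P.ee he x y
    refine P.isCent_of_commute (commute_diag P _) (fun m hm => corner_commute P hm ?_)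
      fun t ht => ?_
    · have h := congrArg (fun z => e * z * f) (H3 m)
      simp only [mul_rightBracket_mul P, neg_neg] at h
      rw [hruleM _ m hxy hm, mul_add, add_mul, peirce_bracket_eq P hxy, add_left_inj,
        ← (isPeirce_bracket P (hdiag _ hxy) hm).sandwich] at h
      rw [← sub_eq_zero] at h
      rw [← h, lieDefect]
      noncomm_ring
    · rw [add_comm]
      refine corner_commute P.symm ht ?_
      have h := congrArg (fun z => f * z * e) (H3 t)
      simp only [mul_rightBracket_mul' P] at h
      rw [hruleN _ t hxy ht, mul_add, add_mul, peirce_bracket_eq P.symm (P.comm_f hxy),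
        add_left_inj, ← (isPeirce_bracket P.symm (P.comm_f (hdiag _ hxy)) ht).sandwich] at h
      rw [← sub_eq_zero] at h
      rw [← h, lieDefect]
      noncomm_ring

end PeirceCompatible

/-- The corner `eAe` has no nonzero element generating a central ideal of `eAe`. -/
def CentralIdealFree {A : Type*} [Ring A] (e : A) : Prop :=
  ∀ x, IsPeirce e e x →
    (∀ a c, IsPeirce e e a → IsPeirce e e c → a * x * c = c * (a * x)) → x = 0

section CentralIdeals

variable {R A : Type*} [CommRing R] [Ring A] [Algebra R A] {φ : A →ₗ[R] A} {e f : A}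

lemma NoNonzeroCentralIdeal.centralIdealFree (he : e * e = e)
    (h : NoNonzeroCentralIdeal R A e) : CentralIdealFree e := by
  intro x hx hc
  have hpe : ∀ a, IsPeirce e e (e * a * e) := fun a =>
    ⟨by simp only [← mul_assoc, he], by simp only [mul_assoc, he]⟩
  have hee : IsPeirce e e e := ⟨he, he⟩
  have hxc : ∀ c, IsPeirce e e c → x * c = c * x := fun c hc' => by
    simpa only [hx.1] using hc e c hee hc'
  refine h {y | ∃ a, IsPeirce e e a ∧ y = a * x} ⟨0, isPeirce_zero, (zero_mul x).symm⟩
    ?_ ?_ ?_ ?_ ?_ ?_ x ⟨e, hee, hx.1.symm⟩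
  · rintro _ ⟨a, ha, rfl⟩
    exact (ha.mul hx).sandwich.symm
  · rintro _ ⟨a, ha, rfl⟩ _ ⟨b, hb, rfl⟩
    exact ⟨a + b, ha.add hb, (add_mul _ _ _).symm⟩
  · rintro r _ ⟨a, ha, rfl⟩
    exact ⟨r • a, ha.smul r, (smul_mul_assoc _ _ _).symm⟩
  · rintro _ ⟨a, ha, rfl⟩ c
    exact ⟨e * c * e * a, (hpe c).mul ha, (mul_assoc _ _ _).symm⟩
  · rintro _ ⟨a, ha, rfl⟩ c
    exact ⟨a * (e * c * e), ha.mul (hpe c), by rw [mul_assoc, hxc _ (hpe c), ← mul_assoc]⟩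
  · rintro _ ⟨a, ha, rfl⟩ c
    exact hc a _ ha (hpe c)

lemma pairing_eq_zero (h2 : TorsionFreeAt A 2) (hI : CentralIdealFree e) {p : A → Prop}
    {S act : A → A → A} (hS : ∀ i j, p i → p j → IsPeirce e e (S i j))
    (hact : ∀ a i, IsPeirce e e a → p i → p (act a i))
    (hl : ∀ a i j, IsPeirce e e a → p i → p j → S (act a i) j = a * S i j)
    (hr : ∀ a i j, IsPeirce e e a → p i → p j → S i (act a j) = S i j * a)
    (hc : ∀ c i j, IsPeirce e e c → p i → p j → (S i j - S j i) * c = c * (S i j - S j i))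
    {i j : A} (hi : p i) (hj : p j) : S i j = 0 := by
  have hsymm : ∀ i j, p i → p j → S i j = S j i := by
    intro i j hi hj
    refine sub_eq_zero.1 (hI _ ((hS i j hi hj).sub (hS j i hj hi)) fun a c ha hc' => ?_)
    have h0 := hc a i j ha hi hj
    have h1 := hc c i (act a j) hc' hi (hact a j ha hj)
    have h3 := hc c j (act a i) hc' hj (hact a i ha hi)
    rw [hl a _ _ ha hj hi, hr a _ _ ha hi hj] at h1
    rw [hl a _ _ ha hi hj, hr a _ _ ha hj hi] at h3
    refine sub_eq_zero.1 (h2 _ ?_)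
    rw [two_nsmul]
    linear_combination (norm := noncomm_ring) h1 - h3 - h0 * c + c * h0
  have hcomm : ∀ a i j, IsPeirce e e a → p i → p j → S i j * a = a * S i j := by
    intro a i j ha hi hj
    rw [← hr a i j ha hi hj, hsymm _ _ hi (hact a j ha hj), hl a _ _ ha hj hi, hsymm _ _ hj hi]
  refine hI _ (hS i j hi hj) fun a c ha hc' => ?_
  rw [← hl a i j ha hi hj, hcomm c _ j hc' (hact a i ha hi) hj]

variable (P : PeirceQ e f) (H : PeirceCompatible e f φ)
include P H

lemma swapM_mul_left {a m : A} (ha : IsPeirce e e a) (hm : IsPeirce e f m) :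
    f * φ (a * m) * e = f * φ m * e * a := by
  have h := H.ruleM_swap a m (PeirceQ.comm_of_ee ha) hm
  rwa [hm.mul_eq_zero ha P.fe, sub_zero, ← mul_assoc a, ← mul_assoc a, P.mulF_of_ee ha,
    zero_mul, zero_mul, sub_zero] at h

lemma swapM_mul_right {b m : A} (hb : IsPeirce f f b) (hm : IsPeirce e f m) :
    f * φ (m * b) * e = b * (f * φ m * e) := by
  have h := H.ruleM_swap b m (P.comm_of_ff hb) hm
  rw [hb.mul_eq_zero hm P.fe, zero_sub, map_neg, mul_assoc (f * φ m), P.symm.fmul_of_ee hb,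
    mul_zero, zero_sub, mul_neg, neg_mul] at h
  exact neg_injective h

lemma corner_defect_commute {x y : A} (hxy : x * y - y * x = 0) {c : A} (hc : IsPeirce e e c) :
    e * (φ x * y - y * φ x + (x * φ y - φ y * x)) * e * c =
      c * (e * (φ x * y - y * φ x + (x * φ y - φ y * x)) * e) := by
  have h := H.defect x y (by rw [hxy, mul_zero, zero_mul]) c
  rw [lieDefect, hxy, map_zero, zero_sub, add_mul, mul_add, mul_assoc (f * _) f, P.fmul_of_ee hc,
    ← mul_assoc c (f * _), ← mul_assoc c f, P.mulF_of_ee hc] at h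
  simpa only [mul_neg, neg_mul, zero_mul, mul_zero, neg_zero, add_zero, neg_inj] using h

lemma swapM_eq_zero (h2 : TorsionFreeAt A 2) (hI : CentralIdealFree e)
    (h3 : ∀ t, IsPeirce f e t → (∀ m, IsPeirce e f m → m * t = 0) →
      (∀ m, IsPeirce e f m → t * m = 0) → t = 0) {m : A} (hm : IsPeirce e f m) :
    f * φ m * e = 0 := by
  have hν : ∀ m, IsPeirce f e (f * φ m * e) := fun m => P.symm.isPeirce_ef _
  have key : ∀ i j, IsPeirce e f i → IsPeirce e f j → i * (f * φ j * e) = 0 := by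
    intro i j hi hj
    refine pairing_eq_zero h2 hI (p := IsPeirce e f) (S := fun i j => i * (f * φ j * e))
      (act := fun a m => a * m) (fun i j hi _ => hi.mul (hν j)) (fun a i ha hi => ha.mul hi)
      (fun a i j _ _ _ => mul_assoc _ _ _) (fun a i j ha _ hj => ?_) (fun c i j hc hi hj => ?_)
      hi hj
    · simp only [swapM_mul_left P H ha hj, mul_assoc]
    · have hij : i * j - j * i = 0 := by
        rw [hi.mul_eq_zero hj P.fe, hj.mul_eq_zero hi P.fe, sub_zero]
      have h := corner_defect_commute P H hij hc
      have hS : e * (φ i * j - j * φ i + (i * φ j - φ j * i)) * e =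
          i * (f * φ j * e) - j * (f * φ i * e) := by
        rw [← mul_assoc i, ← mul_assoc i, hi.2, ← mul_assoc j, ← mul_assoc j, hj.2]
        simp only [mul_add, mul_sub, add_mul, sub_mul, ← mul_assoc, hi.1, hj.1]
        rw [mul_assoc _ j e, mul_assoc _ i e, P.mulE_of_M hi, P.mulE_of_M hj]
        simp only [mul_zero]
        abel
      rwa [hS] at h
  refine h3 _ (hν m) (fun m' hm' => key m' m hm' hm) fun m' hm' => ?_
  refine P.right _ ((hν m).mul hm') (fun t ht => ?_) fun m'' hm'' => ?_
  · rw [mul_assoc, ← swapM_mul_left P H (hm'.mul ht) hm, mul_assoc m',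
      swapM_mul_right P H (ht.mul hm) hm', mul_assoc, key m m' hm hm', mul_zero]
  · rw [← mul_assoc, key m'' m hm'' hm, zero_mul]

lemma swapN_eq_zero (h2 : TorsionFreeAt A 2) (hI : CentralIdealFree e)
    (h3 : ∀ m, IsPeirce e f m → (∀ t, IsPeirce f e t → m * t = 0) →
      (∀ t, IsPeirce f e t → t * m = 0) → m = 0) {t : A} (ht : IsPeirce f e t) :
    e * φ t * f = 0 := by
  have hσ : ∀ t, IsPeirce e f (e * φ t * f) := fun t => P.isPeirce_ef _
  have hr : ∀ a t, IsPeirce e e a → IsPeirce f e t → e * φ (t * a) * f = a * (e * φ t * f) :=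
    fun a t ha ht => swapM_mul_right P.symm (H.symm P) ha ht
  have hl : ∀ b t, IsPeirce f f b → IsPeirce f e t → e * φ (b * t) * f = e * φ t * f * b :=
    fun b t hb ht => swapM_mul_left P.symm (H.symm P) hb ht
  have key : ∀ i j, IsPeirce f e i → IsPeirce f e j → e * φ i * f * j = 0 := by
    intro i j hi hj
    refine pairing_eq_zero h2 hI (p := IsPeirce f e) (S := fun i j => e * φ i * f * j)
      (act := fun a t => t * a) (fun i j _ hj => (hσ i).mul hj) (fun a i ha hi => hi.mul ha)
      (fun a i j ha hi _ => ?_) (fun a i j _ _ _ => (mul_assoc _ _ _).symm)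
      (fun c i j hc hi hj => ?_)
      hi hj
    · simp only [hr a i ha hi, mul_assoc]
    · have hij : i * j - j * i = 0 := by
        rw [hi.mul_eq_zero hj P.ef, hj.mul_eq_zero hi P.ef, sub_zero]
      have h := corner_defect_commute P H hij hc
      have hS : e * (φ i * j - j * φ i + (i * φ j - φ j * i)) * e =
          e * φ i * f * j - e * φ j * f * i := by
        rw [mul_assoc _ f, mul_assoc _ f, hi.1, hj.1]
        simp only [mul_add, mul_sub, add_mul, sub_mul, ← mul_assoc, P.symm.fmul_of_M hi,
          P.symm.fmul_of_M hj]
        rw [mul_assoc _ j e, mul_assoc _ i e, hi.2, hj.2]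
        simp only [zero_mul]
        abel
      rwa [hS] at h
  refine h3 _ (hσ t) (fun t' ht' => key t t' ht ht') fun t' ht' => ?_
  refine P.right _ (ht'.mul (hσ t)) (fun t'' ht'' => ?_) fun m hm => ?_
  · rw [mul_assoc, key t t'' ht ht'', mul_zero]
  · rw [← mul_assoc, ← hr _ t (hm.mul ht') ht, ← mul_assoc, hl _ t' (ht.mul hm) ht', ← mul_assoc,
      key t' t ht' ht, zero_mul]

end CentralIdeals

/-- A linear map preserving the block diagonal part and both off-diagonal Peirce components, acting
like a Lie derivation up to central elements. -/
structure PeirceGraded {R A : Type*} [CommRing R] [Ring A] [Algebra R A] (e f : A)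
    (φ : A →ₗ[R] A) : Prop where
  diag : ∀ w, e * w = w * e → e * φ w = φ w * e
  mapM : ∀ m, IsPeirce e f m → IsPeirce e f (φ m)
  mapN : ∀ t, IsPeirce f e t → IsPeirce f e (φ t)
  ruleM : ∀ w m, e * w = w * e → IsPeirce e f m →
    φ (w * m - m * w) = φ w * m - m * φ w + (w * φ m - φ m * w)
  ruleN : ∀ w t, e * w = w * e → IsPeirce f e t →
    φ (w * t - t * w) = φ w * t - t * φ w + (w * φ t - φ t * w)
  defect_diag : ∀ x y, e * x = x * e → e * y = y * e → IsCent (lieDefect φ x y)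
  defect_offDiag : ∀ m t, IsPeirce e f m → IsPeirce f e t → IsCent (lieDefect φ m t)

section PeirceGraded

variable {R A : Type*} [CommRing R] [Ring A] [Algebra R A] {φ : A →ₗ[R] A} {e f : A}

lemma lieDefect_swap (φ : A →ₗ[R] A) (x y : A) : lieDefect φ x y = -lieDefect φ y x := by
  rw [lieDefect, lieDefect, ← neg_sub (y * x), map_neg]
  abel

lemma PeirceQ.comm_mul {x y : A} (hx : e * x = x * e) (hy : e * y = y * e) :
    e * (x * y) = x * y * e := by
  rw [← mul_assoc, hx, mul_assoc, hy, mul_assoc]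

lemma PeirceQ.comm_sub {x y : A} (hx : e * x = x * e) (hy : e * y = y * e) :
    e * (x - y) = (x - y) * e := by
  rw [mul_sub, hx, hy, sub_mul]

lemma PeirceQ.comm_add {x y : A} (hx : e * x = x * e) (hy : e * y = y * e) :
    e * (x + y) = (x + y) * e := by
  rw [mul_add, hx, hy, add_mul]

lemma PeirceQ.corner_add (P : PeirceQ e f) {x : A} (hx : e * x = x * e) :
    e * x * e + f * x * f = x := by
  rw [hx, mul_assoc, P.ee, P.comm_f hx, mul_assoc, P.ff, ← mul_add, P.sum, mul_one]

lemma PeirceCompatible.peirceGraded (P : PeirceQ e f) (H : PeirceCompatible e f φ)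
    (hM : ∀ m, IsPeirce e f m → f * φ m * e = 0)
    (hN : ∀ t, IsPeirce f e t → e * φ t * f = 0) : PeirceGraded e f φ := by
  have hM' : ∀ m, IsPeirce e f m → e * φ m * f = φ m := fun m hm => by
    rw [H.mapM m hm, hM m hm, add_zero]
    exact (P.isPeirce_ef _).sandwich
  have hN' : ∀ t, IsPeirce f e t → f * φ t * e = φ t := fun t ht => by
    rw [H.mapN t ht, hN t ht, add_zero]
    exact (P.symm.isPeirce_ef _).sandwich
  have mapM : ∀ m, IsPeirce e f m → IsPeirce e f (φ m) := fun m hm => by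
    rw [← hM' m hm]
    exact P.isPeirce_ef _
  have mapN : ∀ t, IsPeirce f e t → IsPeirce f e (φ t) := fun t ht => by
    rw [← hN' t ht]
    exact P.symm.isPeirce_ef _
  have hdef : ∀ x y, e * (x * y - y * x) = (x * y - y * x) * e →
      e * (φ x * y - y * φ x + (x * φ y - φ y * x)) =
        (φ x * y - y * φ x + (x * φ y - φ y * x)) * e → IsCent (lieDefect φ x y) := by
    intro x y h1 h2
    have h := H.defect x y h1
    rwa [P.corner_add (x := lieDefect φ x y) (PeirceQ.comm_sub (H.diag _ h1) h2)] at h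
  refine ⟨H.diag, mapM, mapN, fun w m hw hm => ?_, fun w t hw ht => ?_, fun x y hx hy => ?_,
    fun m t hm ht => ?_⟩
  · have h := H.ruleM w m hw hm
    rwa [hM' _ (isPeirce_bracket P hw hm), hM' _ hm] at h
  · have h := H.ruleN w t hw ht
    rwa [hN' _ (isPeirce_bracket P.symm (P.comm_f hw) ht), hN' _ ht] at h
  · have hx' := H.diag x hx
    have hy' := H.diag y hy
    exact hdef x y (PeirceQ.comm_sub (PeirceQ.comm_mul hx hy) (PeirceQ.comm_mul hy hx))
      (PeirceQ.comm_add (PeirceQ.comm_sub (PeirceQ.comm_mul hx' hy) (PeirceQ.comm_mul hy hx'))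
        (PeirceQ.comm_sub (PeirceQ.comm_mul hx hy') (PeirceQ.comm_mul hy' hx)))
  · have h : ∀ m t, IsPeirce e f m → IsPeirce f e t → e * (m * t - t * m) = (m * t - t * m) * e :=
      fun m t hm ht =>
        PeirceQ.comm_sub (PeirceQ.comm_of_ee (hm.mul ht)) (P.comm_of_ff (ht.mul hm))
    exact hdef m t (h m t hm ht)
      (PeirceQ.comm_add (h _ _ (mapM m hm) ht) (h _ _ hm (mapN t ht)))

/-- `φ a` agrees with an element of `eAe` up to a central element. -/
def CentralModCorner (e : A) (φ : A →ₗ[R] A) (a : A) : Prop :=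
  ∃ x, IsPeirce e e x ∧ IsCent (φ a - x)

namespace PeirceGraded

variable (P : PeirceQ e f) (H : PeirceGraded e f φ)
include P H

lemma symm : PeirceGraded f e φ where
  diag w hw := P.comm_f (H.diag w (P.comm_iff.1 hw))
  mapM := H.mapN
  mapN := H.mapM
  ruleM w t hw := H.ruleN w t (P.comm_iff.1 hw)
  ruleN w t hw := H.ruleM w t (P.comm_iff.1 hw)
  defect_diag x y hx hy := H.defect_diag x y (P.comm_iff.1 hx) (P.comm_iff.1 hy)
  defect_offDiag t m ht hm := by
    rw [lieDefect_swap]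
    exact (H.defect_offDiag m t hm ht).neg

lemma map_mulM {a m : A} (ha : IsPeirce e e a) (hm : IsPeirce e f m) :
    φ (a * m) = φ a * m - m * φ a + a * φ m := by
  have h := H.ruleM a m (PeirceQ.comm_of_ee ha) hm
  rwa [hm.mul_eq_zero ha P.fe, (H.mapM m hm).mul_eq_zero ha P.fe, sub_zero, sub_zero] at h

lemma map_mulN {a t : A} (ha : IsPeirce e e a) (ht : IsPeirce f e t) :
    φ (t * a) = t * φ a - φ a * t + φ t * a := by
  have h := H.ruleN a t (PeirceQ.comm_of_ee ha) ht
  rw [ha.mul_eq_zero ht P.ef, ha.mul_eq_zero (H.mapN t ht) P.ef, zero_sub, zero_sub, map_neg] at h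
  rw [← neg_inj, h]
  abel

lemma centralModCorner_of {a x : A} (ha : IsPeirce e e a) (hx : IsPeirce e e x)
    (hM : ∀ m, IsPeirce e f m → φ a * m - m * φ a = x * m)
    (hN : ∀ t, IsPeirce f e t → t * φ a - φ a * t = t * x) : CentralModCorner e φ a := by
  refine ⟨x, hx, P.isCent_of_commute (PeirceQ.comm_sub (H.diag a (PeirceQ.comm_of_ee ha))
    (PeirceQ.comm_of_ee hx)) (fun m hm => ?_) fun t ht => ?_⟩
  · rw [sub_mul, mul_sub, hm.mul_eq_zero hx P.fe, ← hM m hm]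
    abel
  · rw [sub_mul, mul_sub, hx.mul_eq_zero ht P.ef, ← hN t ht]
    abel

lemma centralModCorner_mul {a b : A} (ha : IsPeirce e e a) (hb : IsPeirce e e b)
    (h1 : CentralModCorner e φ a) (h2 : CentralModCorner e φ b) :
    CentralModCorner e φ (a * b) := by
  obtain ⟨x, hx, hxc⟩ := h1
  obtain ⟨y, hy, hyc⟩ := h2
  have hM : ∀ z c m, IsPeirce e e z → IsCent (φ c - z) → IsPeirce e f m →
      φ c * m - m * φ c = z * m := by
    intro z c m hz hzc hm
    have := hzc m
    rw [sub_mul, mul_sub, hm.mul_eq_zero hz P.fe] at this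
    linear_combination (norm := noncomm_ring) this
  have hN : ∀ z c t, IsPeirce e e z → IsCent (φ c - z) → IsPeirce f e t →
      t * φ c - φ c * t = t * z := by
    intro z c t hz hzc ht
    have := hzc t
    rw [sub_mul, mul_sub, hz.mul_eq_zero ht P.ef] at this
    linear_combination (norm := noncomm_ring) -this
  refine centralModCorner_of P H (ha.mul hb) ((hx.mul hb).add (ha.mul hy))
    (fun m hm => ?_) fun t ht => ?_
  · have h := map_mulM P H (ha.mul hb) hm
    rw [mul_assoc, map_mulM P H ha (hb.mul hm), map_mulM P H hb hm,
      hM x a _ hx hxc (hb.mul hm), hM y b m hy hyc hm] at h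
    linear_combination (norm := noncomm_ring) -h
  · have h := map_mulN P H (ha.mul hb) ht
    rw [← mul_assoc, map_mulN P H hb (ht.mul ha), map_mulN P H ha ht,
      hN y b _ hy hyc (ht.mul ha), hN x a t hx hxc ht] at h
    linear_combination (norm := noncomm_ring) -h

lemma centralModCorner_idempotent {g : A} (hg : IsPeirce e e g) (hgg : g * g = g) :
    CentralModCorner e φ g := by
  have hd := H.diag g (PeirceQ.comm_of_ee hg)
  have hgh : IsPeirce e e (g * φ g) := hg.mul_commute hd
  have hhg : IsPeirce e e (φ g * g) := hg.commute_mul hd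
  refine centralModCorner_of P H hg (x := φ g * g + g * φ g - 2 • (g * (φ g * g)))
    ((hhg.add hgh).sub ?_) (fun m hm => ?_) fun t ht => ?_
  · rw [two_nsmul]
    exact (hg.mul hhg).add (hg.mul hhg)
  · have h := map_mulM P H hg (hg.mul hm)
    rw [← mul_assoc g g m, hgg, map_mulM P H hg hm] at h
    have h' := congrArg (g * ·) h
    simp only [mul_add, mul_sub, ← mul_assoc, hgg] at h h' ⊢
    linear_combination (norm := noncomm_ring) h - 2 • h'
  · have h := map_mulN P H hg (ht.mul hg)
    rw [mul_assoc t g g, hgg, map_mulN P H hg ht] at h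
    have h' := congrArg (· * g) h
    simp only [add_mul, sub_mul, mul_assoc, hgg] at h h' ⊢
    linear_combination (norm := noncomm_ring) h - 2 • h'

omit P in
lemma centralModCorner_commutator {a b : A} (ha : IsPeirce e e a) (hb : IsPeirce e e b) :
    CentralModCorner e φ (a * b - b * a) := by
  have hda := H.diag a (PeirceQ.comm_of_ee ha)
  have hdb := H.diag b (PeirceQ.comm_of_ee hb)
  exact ⟨_, ((hb.commute_mul hda).sub (hb.mul_commute hda)).add
    ((ha.mul_commute hdb).sub (ha.commute_mul hdb)),
    H.defect_diag a b (PeirceQ.comm_of_ee ha) (PeirceQ.comm_of_ee hb)⟩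

lemma centralModCorner_of_generated (hS : CornerGenerated R e) {a : A} (ha : IsPeirce e e a) :
    CentralModCorner e φ a := by
  have h : IsPeirce e e a ∧ CentralModCorner e φ a := by
    rw [← ha.sandwich]
    refine NonUnitalAlgebra.adjoin_induction (R := R) (s := cornerGenSet e)
      (p := fun x _ => IsPeirce e e x ∧ CentralModCorner e φ x) ?_ ?_ ?_ ?_ ?_ (hS a)
    · rintro x (⟨hx, hxx⟩ | ⟨b, c, rfl⟩)
      · have hx' : IsPeirce e e x := hx ▸ P.isPeirce_ee x
        exact ⟨hx', centralModCorner_idempotent P H hx' hxx⟩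
      · have hb := P.isPeirce_ee b
        have hc := P.isPeirce_ee c
        exact ⟨(hb.mul hc).sub (hc.mul hb), centralModCorner_commutator H hb hc⟩
    · rintro x y - - ⟨hx, u, hu, huc⟩ ⟨hy, v, hv, hvc⟩
      refine ⟨hx.add hy, u + v, hu.add hv, ?_⟩
      rw [map_add, add_sub_add_comm]
      exact huc.add hvc
    · refine ⟨isPeirce_zero, 0, isPeirce_zero, ?_⟩
      rw [map_zero, sub_zero]
      exact isCent_zero
    · rintro x y - - ⟨hx, hx'⟩ ⟨hy, hy'⟩
      exact ⟨hx.mul hy, centralModCorner_mul P H hx hy hx' hy'⟩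
    · rintro r x - ⟨hx, u, hu, huc⟩
      refine ⟨hx.smul r, r • u, hu.smul r, ?_⟩
      rw [map_smul, ← smul_sub]
      exact huc.smul r
  exact h.2

end PeirceGraded

end PeirceGraded

/-- Every central element of `eAe` is the corner of a central element of `A`. -/
def CornerCenterLifts {A : Type*} [Ring A] (e : A) : Prop :=
  ∀ x, IsPeirce e e x → (∀ c, IsPeirce e e c → x * c = c * x) → ∃ z, IsCent z ∧ x = e * z

section CornerCenters

variable {R A : Type*} [CommRing R] [Ring A] [Algebra R A] {φ : A →ₗ[R] A} {e f : A}

lemma mem_cornerCenter_iff (he : e * e = e) {x : A} :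
    x ∈ cornerCenter e ↔ IsPeirce e e x ∧ ∀ c, IsPeirce e e c → x * c = c * x := by
  constructor
  · rintro ⟨h1, h2⟩
    refine ⟨?_, fun c hc => by simpa only [hc.sandwich] using h2 c⟩
    rw [h1]
    exact ⟨by simp only [← mul_assoc, he], by simp only [mul_assoc, he]⟩
  · rintro ⟨h1, h2⟩
    exact ⟨h1.sandwich.symm, fun a =>
      h2 _ ⟨by simp only [← mul_assoc, he], by simp only [mul_assoc, he]⟩⟩

lemma cornerCenterLifts_of_eq (he : e * e = e)
    (h : cornerCenter e = (fun z : A => e * z * e) '' centerSet A) : CornerCenterLifts e := by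
  intro x hx hxc
  have hmem : x ∈ cornerCenter e := (mem_cornerCenter_iff he).2 ⟨hx, hxc⟩
  rw [h] at hmem
  obtain ⟨z, hz, rfl⟩ := hmem
  refine ⟨z, hz, ?_⟩
  change e * z * e = e * z
  rw [mul_assoc, hz e, ← mul_assoc, he]

namespace PeirceGraded

variable (P : PeirceQ e f) (H : PeirceGraded e f φ)
include P H

lemma isCent_mixed {a b : A} (ha : IsPeirce e e a) (hb : IsPeirce f f b) :
    IsCent (φ a * b - b * φ a + (a * φ b - φ b * a)) := by
  have h := (H.defect_diag a b (PeirceQ.comm_of_ee ha) (P.comm_of_ff hb)).neg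
  rwa [lieDefect, ha.mul_eq_zero hb P.ef, hb.mul_eq_zero ha P.fe, sub_zero, map_zero, zero_sub,
    neg_neg] at h

lemma isPeirce_mixed {a b : A} (ha : IsPeirce e e a) (hb : IsPeirce f f b) :
    IsPeirce e e (a * φ b - φ b * a) := by
  have hd := H.diag b (P.comm_of_ff hb)
  exact (ha.mul_commute hd).sub (ha.commute_mul hd)

lemma mul_mixed {a b : A} (ha : IsPeirce e e a) (hb : IsPeirce f f b) :
    e * (φ a * b - b * φ a + (a * φ b - φ b * a)) = a * φ b - φ b * a := by
  have h := isPeirce_mixed P.symm (symm P H) hb ha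
  rw [mul_add, (isPeirce_mixed P H ha hb).1, ← neg_sub (b * φ a), mul_neg, P.symm.fmul_of_ee h,
    neg_zero, zero_add]

lemma commute_right_of_left {a b : A} (ha : IsPeirce e e a) (hb : IsPeirce f f b)
    (h : φ a * b = b * φ a) : a * φ b = φ b * a := by
  have hc := isCent_mixed P H ha hb
  rw [h, sub_self, zero_add] at hc
  exact sub_eq_zero.1 (P.symm.eq_zero_of_isCent hc (P.fmul_of_ee (isPeirce_mixed P H ha hb)))

lemma centralModCorner_right (hZ : CornerCenterLifts e) {b : A} (hb : IsPeirce f f b)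
    (h : ∀ a, IsPeirce e e a → a * φ b = φ b * a) : CentralModCorner f φ b := by
  have hd := H.diag b (P.comm_of_ff hb)
  obtain ⟨z, hz, hze⟩ := hZ (e * φ b) (P.isPeirce_emul hd) fun c hc => by
    rw [hd, mul_assoc, hc.1, ← h c hc, ← hd, ← mul_assoc, hc.2]
  have h0 : e * (φ b - z) = 0 := by rw [mul_sub, hze, sub_self]
  have hf : f * (φ b - z) = φ b - z := by rw [P.eq_one_sub, sub_mul, h0, one_mul, sub_zero]
  refine ⟨φ b - z, ⟨hf, ?_⟩, by rwa [sub_sub_cancel]⟩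
  rw [← P.comm_f (PeirceQ.comm_sub hd (hz e).symm), hf]

omit H in
lemma commute_of_centralModCorner {a b : A} (hb : IsPeirce f f b)
    (h : CentralModCorner e φ a) : φ a * b = b * φ a := by
  obtain ⟨x, hx, hxc⟩ := h
  have := hxc b
  rw [sub_mul, mul_sub, hx.mul_eq_zero hb P.ef, hb.mul_eq_zero hx P.fe, sub_zero, sub_zero] at this
  exact this

lemma centralModCorner_of_generated_of_lifts (hS : CornerGenerated R e)
    (hZ : CornerCenterLifts e) :
    (∀ a, IsPeirce e e a → CentralModCorner e φ a) ∧
      ∀ b, IsPeirce f f b → CentralModCorner f φ b := by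
  have h : ∀ a, IsPeirce e e a → CentralModCorner e φ a := fun a ha =>
    centralModCorner_of_generated P H hS ha
  exact ⟨h, fun b hb => centralModCorner_right P H hZ hb fun a ha =>
    commute_right_of_left P H ha hb (commute_of_centralModCorner P hb (h a ha))⟩

lemma centralModCorner_of_lifts (hZe : CornerCenterLifts e) (hZf : CornerCenterLifts f)
    (h : ∀ a b, IsPeirce e e a → IsPeirce f f b → a * φ b = φ b * a) :
    (∀ a, IsPeirce e e a → CentralModCorner e φ a) ∧
      ∀ b, IsPeirce f f b → CentralModCorner f φ b :=
  ⟨fun a ha => centralModCorner_right P.symm (symm P H) hZf ha fun b hb =>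
    commute_right_of_left P.symm (symm P H) hb ha (h a b ha hb).symm,
    fun b hb => centralModCorner_right P H hZe hb fun a ha => h a b ha hb⟩

lemma commute_of_cornerCondStar (hs : CornerCondStar e) {a b : A} (ha : IsPeirce e e a)
    (hb : IsPeirce f f b) : a * φ b = φ b * a := by
  have hd := H.diag b (P.comm_of_ff hb)
  have hl : ∀ c, IsPeirce e e c → e * φ b * c = φ b * c := fun c hc => by
    rw [hd, mul_assoc, hc.1]
  have hr : ∀ c, IsPeirce e e c → c * (e * φ b) = c * φ b := fun c hc => by
    rw [← mul_assoc, hc.2]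
  have h := hs (e * φ b) (P.isPeirce_emul hd).sandwich.symm fun c => by
    have hc := P.isPeirce_ee c
    have hm := isPeirce_mixed P H hc hb
    rw [hl _ hc, hr _ hc, mem_cornerCenter_iff P.ee]
    refine ⟨by simpa using isPeirce_zero.sub hm, fun k hk => ?_⟩
    have hcent := isCent_mixed P H hc hb k
    rw [← neg_sub (_ * φ b), neg_mul, mul_neg, ← mul_mixed P H hc hb, mul_assoc, hcent,
      ← mul_assoc, hk.1, ← mul_assoc k, hk.2]
  have h' := ((mem_cornerCenter_iff P.ee).1 h).2 a ha
  rw [hl a ha, hr a ha] at h'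
  exact h'.symm

lemma commute_of_lieDefect_eq_zero (h0 : ∀ x y, lieDefect φ x y = 0) {a b : A}
    (ha : IsPeirce e e a) (hb : IsPeirce f f b) : a * φ b = φ b * a := by
  have h := h0 a b
  rw [lieDefect, ha.mul_eq_zero hb P.ef, hb.mul_eq_zero ha P.fe, sub_zero, map_zero, zero_sub,
    neg_eq_zero] at h
  have hm := mul_mixed P H ha hb
  rw [h, mul_zero] at hm
  exact sub_eq_zero.1 hm.symm

end PeirceGraded

end CornerCenters

/-- A linear map preserving the Peirce components and satisfying the Leibniz rule for products of a
diagonal and an off-diagonal element, and up to central elements for commutators of off-diagonal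
elements. -/
structure PeirceDeriv {R A : Type*} [CommRing R] [Ring A] [Algebra R A] (e f : A)
    (d : A →ₗ[R] A) : Prop where
  mapE : ∀ a, IsPeirce e e a → IsPeirce e e (d a)
  mapF : ∀ b, IsPeirce f f b → IsPeirce f f (d b)
  mapM : ∀ m, IsPeirce e f m → IsPeirce e f (d m)
  mapN : ∀ t, IsPeirce f e t → IsPeirce f e (d t)
  mulEM : ∀ a m, IsPeirce e e a → IsPeirce e f m → d (a * m) = d a * m + a * d m
  mulMF : ∀ m b, IsPeirce e f m → IsPeirce f f b → d (m * b) = d m * b + m * d b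
  mulFN : ∀ b t, IsPeirce f f b → IsPeirce f e t → d (b * t) = d b * t + b * d t
  mulNE : ∀ t a, IsPeirce f e t → IsPeirce e e a → d (t * a) = d t * a + t * d a
  defect : ∀ m t, IsPeirce e f m → IsPeirce f e t → IsCent (lieDefect d m t)

section Standardness

variable {R A : Type*} [CommRing R] [Ring A] [Algebra R A] {φ : A →ₗ[R] A} {e f : A}

namespace PeirceDeriv

variable {d : A →ₗ[R] A} (P : PeirceQ e f) (D : PeirceDeriv e f d)
include D

lemma symm : PeirceDeriv f e d where
  mapE := D.mapF
  mapF := D.mapE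
  mapM := D.mapN
  mapN := D.mapM
  mulEM := D.mulFN
  mulMF := D.mulNE
  mulFN := D.mulEM
  mulNE := D.mulMF
  defect t m ht hm := by
    rw [lieDefect_swap]
    exact (D.defect m t hm ht).neg

include P

lemma mulEE {a c : A} (ha : IsPeirce e e a) (hc : IsPeirce e e c) :
    d (a * c) = d a * c + a * d c := by
  refine sub_eq_zero.1 (P.left _ ?_ (fun m hm => ?_) fun t ht => ?_)
  · exact (D.mapE _ (ha.mul hc)).sub (((D.mapE a ha).mul hc).add (ha.mul (D.mapE c hc)))
  · have h := D.mulEM _ m (ha.mul hc) hm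
    rw [mul_assoc, D.mulEM a _ ha (hc.mul hm), D.mulEM c m hc hm] at h
    linear_combination (norm := noncomm_ring) -h
  · have h := D.mulNE t _ ht (ha.mul hc)
    rw [← mul_assoc, D.mulNE _ c (ht.mul ha) hc, D.mulNE t a ht ha] at h
    linear_combination (norm := noncomm_ring) -h

lemma mul_offDiag (hI : CentralIdealFree e) {m t : A} (hm : IsPeirce e f m)
    (ht : IsPeirce f e t) :
    d (m * t) = d m * t + m * d t ∧ d (t * m) = d t * m + t * d m := by
  have hε : ∀ m t, IsPeirce e f m → IsPeirce f e t →
      IsPeirce e e (d (m * t) - (d m * t + m * d t)) := fun m t hm ht =>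
    (D.mapE _ (hm.mul ht)).sub (((D.mapM m hm).mul ht).add (hm.mul (D.mapN t ht)))
  have hκ : ∀ m t, IsPeirce e f m → IsPeirce f e t →
      IsPeirce f f (d (t * m) - (d t * m + t * d m)) := fun m t hm ht =>
    (D.mapF _ (ht.mul hm)).sub (((D.mapN t ht).mul hm).add (ht.mul (D.mapM m hm)))
  have hdef : ∀ m t, lieDefect d m t =
      (d (m * t) - (d m * t + m * d t)) - (d (t * m) - (d t * m + t * d m)) := fun m t => by
    rw [lieDefect, map_sub]
    abel
  have hcomm : ∀ m t c, IsPeirce e f m → IsPeirce f e t → IsPeirce e e c →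
      (d (m * t) - (d m * t + m * d t)) * c = c * (d (m * t) - (d m * t + m * d t)) := by
    intro m t c hm ht hc
    have h := D.defect m t hm ht c
    rwa [hdef, sub_mul, mul_sub, (hκ m t hm ht).mul_eq_zero hc P.fe,
      hc.mul_eq_zero (hκ m t hm ht) P.ef, sub_zero, sub_zero] at h
  have h0 : d (m * t) - (d m * t + m * d t) = 0 := by
    refine hI _ (hε m t hm ht) fun a c ha hc => ?_
    have h : a * (d (m * t) - (d m * t + m * d t)) =
        d (a * m * t) - (d (a * m) * t + a * m * d t) := by
      rw [mul_assoc a m t, mulEE P D ha (hm.mul ht), D.mulEM a m ha hm]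
      noncomm_ring
    rw [h, hcomm _ t c (ha.mul hm) ht hc]
  have h1 := D.defect m t hm ht
  rw [hdef, h0, zero_sub] at h1
  have h2 := P.eq_zero_of_isCent h1 (by rw [mul_neg, P.symm.fmul_of_ee (hκ m t hm ht), neg_zero])
  exact ⟨sub_eq_zero.1 h0, sub_eq_zero.1 (neg_eq_zero.1 h2)⟩

lemma isDeriv (hI : CentralIdealFree e ∨ CentralIdealFree f) : IsDeriv d := by
  have hoff : ∀ m t, IsPeirce e f m → IsPeirce f e t →
      d (m * t) = d m * t + m * d t ∧ d (t * m) = d t * m + t * d m := fun m t hm ht =>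
    hI.elim (fun h => mul_offDiag P D h hm ht)
      fun h => (mul_offDiag P.symm (symm D) h ht hm).symm
  have hzero : ∀ {g h k l x y : A}, h * k = 0 → IsPeirce g h x → IsPeirce k l y →
      IsPeirce g h (d x) → IsPeirce k l (d y) → d (x * y) = d x * y + x * d y := by
    intro g h k l x y hhk hx hy hdx hdy
    rw [hx.mul_eq_zero hy hhk, hdx.mul_eq_zero hy hhk, hx.mul_eq_zero hdy hhk, map_zero, add_zero]
  have hadd : ∀ x y z, d (x * y) = d x * y + x * d y → d (x * z) = d x * z + x * d z →
      d (x * (y + z)) = d x * (y + z) + x * d (y + z) := by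
    intro x y z hy hz
    rw [mul_add, map_add, hy, hz, map_add]
    noncomm_ring
  refine P.induction (fun x y hx hy z => ?_) (fun x hx => ?_) (fun x hx => ?_) (fun x hx => ?_)
    fun x hx => ?_
  · rw [add_mul, map_add, hx, hy, map_add]
    noncomm_ring
  · exact P.induction (hadd x) (fun y hy => mulEE P D hx hy) (fun y hy => D.mulEM x y hx hy)
      (fun y hy => hzero P.ef hx hy (D.mapE x hx) (D.mapN y hy))
      fun y hy => hzero P.ef hx hy (D.mapE x hx) (D.mapF y hy)
  · exact P.induction (hadd x) (fun y hy => hzero P.fe hx hy (D.mapM x hx) (D.mapE y hy))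
      (fun y hy => hzero P.fe hx hy (D.mapM x hx) (D.mapM y hy))
      (fun y hy => (hoff x y hx hy).1) fun y hy => D.mulMF x y hx hy
  · exact P.induction (hadd x) (fun y hy => D.mulNE x y hx hy) (fun y hy => (hoff y x hy hx).2)
      (fun y hy => hzero P.ef hx hy (D.mapN x hx) (D.mapN y hy))
      fun y hy => hzero P.ef hx hy (D.mapN x hx) (D.mapF y hy)
  · exact P.induction (hadd x) (fun y hy => hzero P.fe hx hy (D.mapF x hx) (D.mapE y hy))
      (fun y hy => hzero P.fe hx hy (D.mapF x hx) (D.mapM y hy))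
      (fun y hy => D.mulFN x y hx hy) fun y hy => mulEE P.symm (symm D) hx hy

end PeirceDeriv

lemma exists_central_lift (P : PeirceQ e f) (g : A →ₗ[R] A)
    (h : ∀ x, ∃ z, IsCent z ∧ f * z = g x) :
    ∃ γ : A →ₗ[R] A, (∀ x, IsCent (γ x)) ∧ ∀ x, f * γ x = g x := by
  choose γ hc hγ using h
  have hu : ∀ z z', IsCent z → IsCent z' → f * z = f * z' → z = z' := fun z z' hz hz' h =>
    sub_eq_zero.1 (P.symm.eq_zero_of_isCent (hz.sub hz') (by rw [mul_sub, h, sub_self]))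
  exact ⟨{
    toFun := γ
    map_add' := fun x y => hu _ _ (hc _) ((hc x).add (hc y)) (by
      rw [mul_add, hγ, hγ, hγ, map_add])
    map_smul' := fun r x => hu _ _ (hc _) ((hc x).smul r) (by
      rw [RingHom.id_apply, mul_smul_comm, hγ, hγ, map_smul]) }, hc, hγ⟩

/-- The central part of `φ` on `eAe`, extended by zero to the other Peirce components. -/
lemma PeirceGraded.exists_central_part (P : PeirceQ e f)
    (hE : ∀ a, IsPeirce e e a → CentralModCorner e φ a) :
    ∃ γ : A →ₗ[R] A, (∀ x, IsCent (γ x)) ∧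
      (∀ a, IsPeirce e e a → IsPeirce e e (φ a - γ a)) ∧ ∀ x, e * x * e = 0 → γ x = 0 := by
  let g : A →ₗ[R] A := LinearMap.mulLeft R f ∘ₗ LinearMap.mulRight R f ∘ₗ φ ∘ₗ
    LinearMap.mulLeft R e ∘ₗ LinearMap.mulRight R e
  have hg : ∀ x, g x = f * φ (e * x * e) * f := fun x => by
    simp only [g, LinearMap.comp_apply, LinearMap.mulLeft_apply, LinearMap.mulRight_apply,
      mul_assoc]
  have hl : ∀ x z, IsPeirce e e z → IsCent (φ (e * x * e) - z) →
      f * (φ (e * x * e) - z) = g x := by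
    intro x z hz hc
    have h := (hc f).symm
    rw [hg, ← P.ff, mul_assoc f f, h, P.ff, sub_mul, P.mulF_of_ee hz, sub_zero, ← mul_assoc]
  obtain ⟨γ, hc, hγ⟩ := exists_central_lift P g fun x => by
    obtain ⟨z, hz, hzc⟩ := hE _ (P.isPeirce_ee x)
    exact ⟨_, hzc, hl x z hz hzc⟩
  refine ⟨γ, hc, fun a ha => ?_, fun x hx => ?_⟩
  · obtain ⟨z, hz, hzc⟩ := hE a ha
    have h := hl a z hz
    rw [ha.sandwich] at h
    have h' := P.symm.eq_zero_of_isCent (hzc.sub (hc a)) (by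
      rw [mul_sub, hγ, h hzc, sub_self])
    have : φ a - γ a = z := by
      rw [← sub_eq_zero, ← h']
      abel
    rwa [this]
  · refine P.symm.eq_zero_of_isCent (hc x) ?_
    rw [hγ, hg, hx, map_zero, mul_zero, zero_mul]

lemma PeirceGraded.exists_isDeriv_add (P : PeirceQ e f) (H : PeirceGraded e f φ)
    (hE : ∀ a, IsPeirce e e a → CentralModCorner e φ a)
    (hF : ∀ b, IsPeirce f f b → CentralModCorner f φ b)
    (hI : CentralIdealFree e ∨ CentralIdealFree f) :
    ∃ d : A →ₗ[R] A, IsDeriv d ∧ ∀ x, IsCent (φ x - d x) := by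
  obtain ⟨γ, hγ, hγE, hγ0⟩ := PeirceGraded.exists_central_part P hE
  obtain ⟨δ, hδ, hδF, hδ0⟩ := PeirceGraded.exists_central_part P.symm hF
  let d := φ - γ - δ
  have hdE : ∀ a, IsPeirce e e a → d a = φ a - γ a := fun a ha => by
    have : δ a = 0 := hδ0 a (by rw [P.fmul_of_ee ha, zero_mul])
    simp only [d, LinearMap.sub_apply, this, sub_zero]
  have hdF : ∀ b, IsPeirce f f b → d b = φ b - δ b := fun b hb => by
    have : γ b = 0 := hγ0 b (by rw [P.symm.fmul_of_ee hb, zero_mul])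
    simp only [d, LinearMap.sub_apply, this, sub_zero]
  have hdM : ∀ m, IsPeirce e f m → d m = φ m := fun m hm => by
    have h1 : γ m = 0 := hγ0 m (by rw [mul_assoc, P.mulE_of_M hm, mul_zero])
    have h2 : δ m = 0 := hδ0 m (by rw [P.fmul_of_M hm, zero_mul])
    simp only [d, LinearMap.sub_apply, h1, h2, sub_zero]
  have hdN : ∀ t, IsPeirce f e t → d t = φ t := fun t ht => by
    have h1 : γ t = 0 := hγ0 t (by rw [P.symm.fmul_of_M ht, zero_mul])
    have h2 : δ t = 0 := hδ0 t (by rw [mul_assoc, P.symm.mulE_of_M ht, mul_zero])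
    simp only [d, LinearMap.sub_apply, h1, h2, sub_zero]
  have hmapE : ∀ a, IsPeirce e e a → IsPeirce e e (d a) := fun a ha => hdE a ha ▸ hγE a ha
  have hmapF : ∀ b, IsPeirce f f b → IsPeirce f f (d b) := fun b hb => hdF b hb ▸ hδF b hb
  have hcent : ∀ x, IsCent (φ x - d x) := fun x => by
    have : φ x - d x = γ x + δ x := by
      simp only [d, LinearMap.sub_apply]
      abel
    exact this ▸ (hγ x).add (hδ x)
  have hbr : ∀ x y, φ x * y - y * φ x = d x * y - y * d x := fun x y => by
    have := hcent x y
    rw [sub_mul, mul_sub] at this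
    linear_combination (norm := noncomm_ring) this
  refine ⟨d, PeirceDeriv.isDeriv P (f := f) ⟨hmapE, hmapF, fun m hm => hdM m hm ▸ H.mapM m hm,
    fun t ht => hdN t ht ▸ H.mapN t ht, fun a m ha hm => ?_, fun m b hm hb => ?_,
    fun b t hb ht => ?_, fun t a ht ha => ?_, fun m t hm ht => ?_⟩ hI, hcent⟩
  · rw [hdM _ (ha.mul hm), hdM m hm, PeirceGraded.map_mulM P H ha hm, hbr,
      hm.mul_eq_zero (hmapE a ha) P.fe, sub_zero]
  · rw [hdM _ (hm.mul hb), hdM m hm, PeirceGraded.map_mulN P.symm (symm P H) hb hm,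
      ← neg_sub (φ b * m), hbr, (hmapF b hb).mul_eq_zero hm P.fe, zero_sub, neg_neg, add_comm]
  · rw [hdN _ (hb.mul ht), hdN t ht, PeirceGraded.map_mulM P.symm (symm P H) hb ht, hbr,
      ht.mul_eq_zero (hmapF b hb) P.ef, sub_zero]
  · rw [hdN _ (ht.mul ha), hdN t ht, PeirceGraded.map_mulN P H ha ht,
      ← neg_sub (φ a * t), hbr, (hmapE a ha).mul_eq_zero ht P.ef, zero_sub, neg_neg, add_comm]
  · have h : lieDefect d m t =
        lieDefect φ m t - (φ (m * t - t * m) - d (m * t - t * m)) := by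
      rw [lieDefect, lieDefect, hdM m hm, hdN t ht]
      abel
    rw [h]
    exact (H.defect_offDiag m t hm ht).sub (hcent _)

end Standardness

section Assembly

variable {R A : Type*} [CommRing R] [Ring A] [Algebra R A] {φ : A →ₗ[R] A} {e f : A} {n : ℕ}

lemma peirceQ_of_propQ (he : e * e = e) (hQ : PropQ e) : PeirceQ e (1 - e) := by
  have hff : (1 - e) * (1 - e) = 1 - e := by
    rw [mul_sub, sub_mul, sub_mul, mul_one, one_mul, mul_one, he, sub_self, sub_zero]
  have hM : ∀ y, IsPeirce e (1 - e) (e * y * (1 - e)) := fun y =>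
    ⟨by simp only [← mul_assoc, he], by rw [mul_assoc, hff]⟩
  have hN : ∀ y, IsPeirce (1 - e) e ((1 - e) * y * e) := fun y =>
    ⟨by simp only [← mul_assoc, hff], by rw [mul_assoc, he]⟩
  refine ⟨he, hff, by rw [mul_sub, mul_one, he, sub_self], by rw [sub_mul, one_mul, he, sub_self],
    add_sub_cancel _ _, fun a ha h h' => ?_, fun b hb h h' => ?_⟩
  · rw [← ha.sandwich]
    refine hQ.1 a ⟨fun y => ?_, fun y => ?_⟩ <;> rw [ha.sandwich]
    · exact h _ (hM y)
    · exact h' _ (hN y)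
  · rw [← hb.sandwich]
    refine hQ.2 b ⟨fun y => ?_, fun y => ?_⟩ <;> rw [hb.sandwich]
    · exact h' _ (hM y)
    · exact h _ (hN y)

lemma peirceQ_of_hypotheses (he : e * e = e) (he0 : e ≠ 0) (hQ : PropQ e)
    (hyp2 :
      (NoNonzeroCentralIdeal R A e ∨ NoNonzeroCentralIdeal R A (1 - e)) ∨
      (∀ m t : A, (e * m * (1 - e)) * ((1 - e) * t * e) = 0 ∧
        ((1 - e) * t * e) * (e * m * (1 - e)) = 0))
    (hyp3 : ∀ x : A,
      (((∀ y : A, (e * x * (1 - e)) * ((1 - e) * y * e) = 0) ∧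
        (∀ y : A, ((1 - e) * y * e) * (e * x * (1 - e)) = 0)) →
          e * x * (1 - e) = 0) ∧
      (((∀ y : A, (e * y * (1 - e)) * ((1 - e) * x * e) = 0) ∧
        (∀ y : A, ((1 - e) * x * e) * (e * y * (1 - e)) = 0)) →
          (1 - e) * x * e = 0)) :
    PeirceQ e (1 - e) ∧ (CentralIdealFree e ∨ CentralIdealFree (1 - e)) ∧
      (∀ t, IsPeirce (1 - e) e t → (∀ m, IsPeirce e (1 - e) m → m * t = 0) →
        (∀ m, IsPeirce e (1 - e) m → t * m = 0) → t = 0) ∧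
      ∀ m, IsPeirce e (1 - e) m → (∀ t, IsPeirce (1 - e) e t → m * t = 0) →
        (∀ t, IsPeirce (1 - e) e t → t * m = 0) → m = 0 := by
  have P := peirceQ_of_propQ he hQ
  refine ⟨P, ?_, fun t ht h h' => ?_, fun m hm h h' => ?_⟩
  · rcases hyp2 with (h | h) | h
    · exact Or.inl (h.centralIdealFree he)
    · exact Or.inr (h.centralIdealFree P.ff)
    · refine absurd (P.left e ⟨he, he⟩ (fun m hm => ?_) fun t ht => ?_) he0
      · rw [hm.1, ← hm.sandwich]
        exact (hyp3 m).1 ⟨fun y => (h m y).1, fun y => (h m y).2⟩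
      · rw [ht.2, ← ht.sandwich]
        exact (hyp3 t).2 ⟨fun y => (h y t).1, fun y => (h y t).2⟩
  · rw [← ht.sandwich]
    refine (hyp3 t).2 ⟨fun y => ?_, fun y => ?_⟩ <;> rw [ht.sandwich]
    · exact h _ (P.isPeirce_ef y)
    · exact h' _ (P.isPeirce_ef y)
  · rw [← hm.sandwich]
    refine (hyp3 m).1 ⟨fun y => ?_, fun y => ?_⟩ <;> rw [hm.sandwich]
    · exact h _ (P.symm.isPeirce_ef y)
    · exact h' _ (P.symm.isPeirce_ef y)

lemma PeirceCompatible.peirceGraded_of_centralIdealFree (P : PeirceQ e f)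
    (H : PeirceCompatible e f φ) (h2 : TorsionFreeAt A 2)
    (hI : CentralIdealFree e ∨ CentralIdealFree f)
    (hN : ∀ t, IsPeirce f e t → (∀ m, IsPeirce e f m → m * t = 0) →
      (∀ m, IsPeirce e f m → t * m = 0) → t = 0)
    (hM : ∀ m, IsPeirce e f m → (∀ t, IsPeirce f e t → m * t = 0) →
      (∀ t, IsPeirce f e t → t * m = 0) → m = 0) : PeirceGraded e f φ := by
  rcases hI with hI | hI
  · exact H.peirceGraded P (fun m hm => swapM_eq_zero P H h2 hI hN hm)
      fun t ht => swapN_eq_zero P H h2 hI hM ht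
  · exact H.peirceGraded P
      (fun m hm => swapN_eq_zero P.symm (H.symm P) h2 hI
        (fun t ht h h' => hN t ht h' h) hm)
      fun t ht => swapM_eq_zero P.symm (H.symm P) h2 hI
        (fun m hm h h' => hM m hm h' h) ht

lemma PeirceGraded.centralModCorner (P : PeirceQ e f) (H : PeirceGraded e f φ) (hn : 2 ≤ n)
    (hφ : IsLieNDeriv n φ)
    (hyp1 :
      (CornerGenerated R e ∧ CornerGenerated R f) ∨
      (CornerGenerated R e ∧ cornerCenter e = (fun z : A => e * z * e) '' centerSet A) ∨
      (CornerGenerated R f ∧ cornerCenter f = (fun z : A => f * z * f) '' centerSet A) ∨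
      (cornerCenter e = (fun z : A => e * z * e) '' centerSet A ∧
        cornerCenter f = (fun z : A => f * z * f) '' centerSet A ∧
        (3 ≤ n → CornerCondStar e ∨ CornerCondStar f))) :
    (∀ a, IsPeirce e e a → CentralModCorner e φ a) ∧
      ∀ b, IsPeirce f f b → CentralModCorner f φ b := by
  rcases hyp1 with ⟨hSe, hSf⟩ | ⟨hSe, hZe⟩ | ⟨hSf, hZf⟩ | ⟨hZe, hZf, hs⟩
  · exact ⟨fun a ha => centralModCorner_of_generated P H hSe ha,
      fun b hb => centralModCorner_of_generated P.symm (symm P H) hSf hb⟩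
  · exact centralModCorner_of_generated_of_lifts P H hSe (cornerCenterLifts_of_eq P.ee hZe)
  · exact (centralModCorner_of_generated_of_lifts P.symm (symm P H) hSf
      (cornerCenterLifts_of_eq P.ff hZf)).symm
  · refine centralModCorner_of_lifts P H (cornerCenterLifts_of_eq P.ee hZe)
      (cornerCenterLifts_of_eq P.ff hZf) fun a b ha hb => ?_
    rcases hn.eq_or_lt with rfl | hn
    · exact commute_of_lieDefect_eq_zero P H (lieDefect_eq_zero hφ) ha hb
    · rcases hs hn with hs | hs
      · exact commute_of_cornerCondStar P H hs ha hb
      · exact commute_right_of_left P H ha hb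
          (commute_of_cornerCondStar P.symm (symm P H) hs hb ha).symm

end Assembly

theorem stmt_12 (R : Type*) [CommRing R] (A : Type*) [Ring A] [Algebra R A]
    (n : ℕ) (hn : 2 ≤ n)
    (h2 : TorsionFreeAt A 2) (hn1 : TorsionFreeAt A (n - 1))
    (e : A) (he : e * e = e) (he0 : e ≠ 0) (he1 : e ≠ 1) (hQ : PropQ e)
    (hyp1 :
      (CornerGenerated R e ∧ CornerGenerated R (1 - e)) ∨
      (CornerGenerated R e ∧
        cornerCenter e = (fun z : A => e * z * e) '' centerSet A) ∨
      (CornerGenerated R (1 - e) ∧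
        cornerCenter (1 - e) = (fun z : A => (1 - e) * z * (1 - e)) '' centerSet A) ∨
      (cornerCenter e = (fun z : A => e * z * e) '' centerSet A ∧
        cornerCenter (1 - e) = (fun z : A => (1 - e) * z * (1 - e)) '' centerSet A ∧
        (3 ≤ n → CornerCondStar e ∨ CornerCondStar (1 - e))))
    (hyp2 :
      (NoNonzeroCentralIdeal R A e ∨ NoNonzeroCentralIdeal R A (1 - e)) ∨
      (∀ m t : A, (e * m * (1 - e)) * ((1 - e) * t * e) = 0 ∧
        ((1 - e) * t * e) * (e * m * (1 - e)) = 0))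
    (hyp3 : ∀ x : A,
      (((∀ y : A, (e * x * (1 - e)) * ((1 - e) * y * e) = 0) ∧
        (∀ y : A, ((1 - e) * y * e) * (e * x * (1 - e)) = 0)) →
          e * x * (1 - e) = 0) ∧
      (((∀ y : A, (e * y * (1 - e)) * ((1 - e) * x * e) = 0) ∧
        (∀ y : A, ((1 - e) * x * e) * (e * y * (1 - e)) = 0)) →
          (1 - e) * x * e = 0)) :
    ∀ φ : A →ₗ[R] A, IsLieNDeriv n φ → IsStandardLieNDeriv n φ := by
  obtain ⟨P, hI, h3N, h3M⟩ := peirceQ_of_hypotheses he he0 hQ hyp2 hyp3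
  intro φ hφ
  let s := e * φ e * (1 - e) - (1 - e) * φ e * e
  obtain ⟨d₀, hd₀, hs⟩ := isDeriv_inner (R := R) s
  have hψ : IsLieNDeriv n (φ - d₀) := hφ.sub_isDeriv (by omega) hd₀
  have hcomm : e * (φ - d₀) e = (φ - d₀) e * e := by
    have he' : ∀ x, e * (e * x) = e * x := fun x => by rw [← mul_assoc, he]
    simp only [LinearMap.sub_apply, hs, s, mul_sub, sub_mul, mul_one, one_mul, mul_assoc, he, he']
    abel
  have hcent := hψ.isCent_map_idempotent P hn hn1 hcomm
  have H : PeirceGraded e (1 - e) (φ - d₀) :=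
    (hψ.peirceCompatible P hn hcent).peirceGraded_of_centralIdealFree P h2 hI h3N h3M
  obtain ⟨hE, hF⟩ := PeirceGraded.centralModCorner P H hn hψ hyp1
  obtain ⟨d, hd, hdc⟩ := PeirceGraded.exists_isDeriv_add P H hE hF hI
  have hc : ∀ x, IsCent ((φ - (d + d₀)) x) := fun x => by
    have h : (φ - (d + d₀)) x = (φ - d₀) x - d x := by
      simp only [LinearMap.sub_apply, LinearMap.add_apply]
      abel
    exact h ▸ hdc x
  exact ⟨d + d₀, φ - (d + d₀), hd.add hd₀, hc,
    (hφ.sub_isDeriv (by omega) (hd.add hd₀)).vanishes hn hc, (add_sub_cancel _ _).symm⟩
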